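/- arXiv:1401.0542 — 2 statements merged into one kernel-verified Lean document; each statement's English description precedes it below -/
import Mathlib

section
/- Any two distinct probabilists' Hermite polynomials have at most the root x = 0 in common: for natural numbers m ≠ n and any real number x, if H_m(x) = 0 and H_n(x) = 0, then x = 0. -/
open Polynomial

theorem Nat.choose_le_pow_card {n k : ℕ} (hkn : k ≤ n) (hn : 0 < n) (S : Finset ℕ)
    (hS : ∀ p, p.Prime → p ∣ n.choose k → p ∈ S) : n.choose k ≤ n ^ S.card := by
  have hne : n.choose k ≠ 0 := (Nat.choose_pos hkn).ne'
  calc n.choose k = ∏ p ∈ (n.choose k).primeFactors, p ^ (n.choose k).factorization p :=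
        (Nat.prod_factorization_pow_eq_self hne).symm
    _ ≤ ∏ _p ∈ (n.choose k).primeFactors, n :=
        Finset.prod_le_prod' fun p _ => Nat.pow_factorization_choose_le hn
    _ = n ^ (n.choose k).primeFactors.card := by simp
    _ ≤ n ^ S.card := by
        refine Nat.pow_le_pow_right hn (Finset.card_le_card fun p hp => ?_)
        exact hS p (Nat.prime_of_mem_primeFactors hp) (Nat.dvd_of_mem_primeFactors hp)

theorem Nat.pow_le_pow_mul_choose {n k : ℕ} (hkn : k ≤ n) : n ^ k ≤ k ^ k * n.choose k := by
  induction k generalizing n with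
  | zero => simp
  | succ k ih =>
    obtain ⟨n, rfl⟩ : ∃ m, n = m + 1 := ⟨n - 1, by omega⟩
    have h1 := ih (Nat.le_of_succ_le_succ hkn)
    have h2 := Nat.add_one_mul_choose_eq n k
    rcases Nat.eq_zero_or_pos k with rfl | hk
    · simp
    have h3 : (n + 1) * k ≤ (k + 1) * n := by nlinarith
    have h4 := Nat.pow_le_pow_left h3 k
    rw [mul_pow, mul_pow] at h4
    refine Nat.le_of_mul_le_mul_left ?_ (pow_pos hk k)
    calc k ^ k * (n + 1) ^ (k + 1) = (n + 1) * ((n + 1) ^ k * k ^ k) := by ring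
      _ ≤ (n + 1) * ((k + 1) ^ k * n ^ k) := Nat.mul_le_mul_left _ h4
      _ ≤ (n + 1) * ((k + 1) ^ k * (k ^ k * n.choose k)) := by gcongr
      _ = (k + 1) ^ k * k ^ k * ((n + 1) * n.choose k) := by ring
      _ = k ^ k * ((k + 1) ^ (k + 1) * (n + 1).choose (k + 1)) := by rw [h2]; ring

theorem Nat.pow_lt_pow_mul_choose {n k : ℕ} (hk : 2 ≤ k) (hkn : k < n) :
    n ^ k < k ^ k * n.choose k := by
  obtain ⟨k, rfl⟩ : ∃ m, k = m + 1 := ⟨k - 1, by omega⟩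
  obtain ⟨n, rfl⟩ : ∃ m, n = m + 1 := ⟨n - 1, by omega⟩
  have h1 := Nat.pow_le_pow_mul_choose (n := n) (k := k) (by omega)
  have h2 := Nat.add_one_mul_choose_eq n k
  have h3 : (n + 1) * k < (k + 1) * n := by nlinarith
  have h4 := Nat.pow_lt_pow_left h3 (n := k) (by omega)
  rw [mul_pow, mul_pow] at h4
  refine Nat.lt_of_mul_lt_mul_left (a := k ^ k) ?_
  calc k ^ k * (n + 1) ^ (k + 1) = (n + 1) * ((n + 1) ^ k * k ^ k) := by ring
    _ < (n + 1) * ((k + 1) ^ k * n ^ k) := Nat.mul_lt_mul_of_pos_left h4 (by omega)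
    _ ≤ (n + 1) * ((k + 1) ^ k * (k ^ k * n.choose k)) := by gcongr
    _ = (k + 1) ^ k * k ^ k * ((n + 1) * n.choose k) := by ring
    _ = k ^ k * ((k + 1) ^ (k + 1) * (n + 1).choose (k + 1)) := by rw [h2]; ring

theorem Nat.pow_lt_choose_of_sq_le {n t e : ℕ} (ht : 2 ≤ t) (htn : t ^ 2 ≤ n) (he : 2 * e ≤ t) :
    n ^ e < n.choose t := by
  have hn : t < n := by nlinarith
  by_contra! hle
  have h1 := Nat.pow_lt_pow_mul_choose ht hn
  have h2 : n ^ t < t ^ t * n ^ e := h1.trans_le (Nat.mul_le_mul_left _ hle)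
  have h3 : (n ^ t) ^ 2 < (t ^ t * n ^ e) ^ 2 := Nat.pow_lt_pow_left h2 (by norm_num)
  have h4 : (t ^ t * n ^ e) ^ 2 ≤ n ^ t * n ^ t := by
    calc (t ^ t * n ^ e) ^ 2 = (t ^ 2) ^ t * n ^ (2 * e) := by ring
      _ ≤ n ^ t * n ^ t := by
        gcongr
        · omega
  rw [sq (n ^ t)] at h3
  omega

theorem Nat.choose_le_choose_of_le_half {n s k : ℕ} (hsk : s ≤ k) (hk : 2 * k ≤ n) :
    n.choose s ≤ n.choose k := by
  induction k, hsk using Nat.le_induction with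
  | base => exact le_rfl
  | succ k _ ih =>
    exact (ih (by omega)).trans (Nat.choose_le_succ_of_lt_half_left (by omega))

theorem Nat.primeCounting_add_two_le {s : ℕ} (hs : 2 ≤ s) :
    Nat.primeCounting (s + 2) ≤ Nat.primeCounting s + 1 := by
  simp only [Nat.primeCounting, Nat.primeCounting', Nat.count_succ]
  have : ¬ ((s + 1).Prime ∧ (s + 2).Prime) := by
    rintro ⟨h1, h2⟩
    have := h1.eq_two_or_odd
    have := h2.eq_two_or_odd
    omega
  split_ifs <;> simp_all

theorem Nat.two_mul_primeCounting_le {s : ℕ} (hs : 8 ≤ s) : 2 * Nat.primeCounting s ≤ s := by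
  induction s using Nat.strong_induction_on with
  | _ s ih =>
    rcases lt_or_ge s 10 with h | h
    · interval_cases s <;> decide
    · obtain ⟨r, rfl⟩ : ∃ r, s = r + 2 := ⟨s - 2, by omega⟩
      have := ih r (by omega) (by omega)
      have := Nat.primeCounting_add_two_le (s := r) (by omega)
      omega

theorem Nat.two_mul_primeCounting_add_two_le {s : ℕ} (hs : 14 ≤ s) :
    2 * (Nat.primeCounting s + 1) ≤ s := by
  induction s using Nat.strong_induction_on with
  | _ s ih =>
    rcases lt_or_ge s 16 with h | h
    · interval_cases s <;> decide
    · obtain ⟨r, rfl⟩ : ∃ r, s = r + 2 := ⟨s - 2, by omega⟩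
      have := ih r (by omega) (by omega)
      have := Nat.primeCounting_add_two_le (s := r) (by omega)
      omega

theorem Nat.Prime.not_dvd_choose_of_mod_le_of_lt_sq {p n k : ℕ} (hp : p.Prime)
    (hk : k % p ≤ n % p) (hkn : k ≤ n) (hn : n < p ^ 2) : ¬ p ∣ n.choose k := by
  have := Fact.mk hp
  intro h
  have h1 := Choose.choose_modEq_choose_mod_mul_choose_div_nat (n := n) (k := k) (p := p)
  rw [Nat.ModEq, Nat.mod_eq_zero_of_dvd h, eq_comm, ← Nat.dvd_iff_mod_eq_zero,
    hp.dvd_mul] at h1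
  have key : ∀ a b, b ≤ a → a < p → ¬ p ∣ a.choose b := fun a b hb ha hd => by
    have := hd.trans (Nat.choose_mul_factorial_mul_factorial hb ▸
      Dvd.intro _ (mul_assoc _ _ _).symm : a.choose b ∣ a.factorial)
    exact absurd ((hp.dvd_factorial).1 this) (by omega)
  rcases h1 with h1 | h1
  · exact key _ _ hk (Nat.mod_lt _ hp.pos) h1
  · exact key _ _ (Nat.div_le_div_right hkn) (Nat.div_lt_of_lt_mul (by rwa [← sq])) h1

theorem Nat.Prime.not_dvd_choose_of_le_mod {p n k : ℕ} (hp : p.Prime)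
    (hk : k ≤ n % p) : ¬ p ∣ n.choose k := by
  have := Fact.mk hp
  intro h
  have hlt := Nat.mod_lt n hp.pos
  have h1 := Choose.choose_modEq_choose_mod_mul_choose_div_nat (n := n) (k := k) (p := p)
  rw [Nat.ModEq, Nat.mod_eq_zero_of_dvd h, eq_comm, ← Nat.dvd_iff_mod_eq_zero,
    Nat.div_eq_of_lt (by omega : k < p), Nat.mod_eq_of_lt (by omega : k < p), Nat.choose_zero_right,
    mul_one] at h1
  have := h1.trans (Nat.choose_mul_factorial_mul_factorial hk ▸
      Dvd.intro _ (mul_assoc _ _ _).symm : (n % p).choose k ∣ (n % p).factorial)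
  exact absurd ((hp.dvd_factorial).1 this) (by omega)

/-- The congruence conditions on `n` and `k` forced by an even factor of degree `k` of the `n`-th
Hermite polynomial. -/
structure HermiteFactorDegree (n k : ℕ) : Prop where
  le_mod_of_lt : ∀ p, p.Prime → p ≠ 2 → k + 1 < p → k ≤ n % p
  le_mod_of_even : Even n → ∀ p, p.Prime → p ≠ 2 → k < p → k ≤ n % p
  mod_le_mod : ∀ p, p.Prime → p ≠ 2 → n < p ^ 2 → k % p ≤ n % p ∨ p ∣ k + 1

namespace HermiteFactorDegree

variable {n k : ℕ}

theorem le_add_one_of_dvd_choose (h : HermiteFactorDegree n k) (hk : 2 ≤ k) {p : ℕ}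
    (hp : p.Prime) (hd : p ∣ n.choose k) : p ≤ k + 1 := by
  by_contra! hlt
  exact hp.not_dvd_choose_of_le_mod (h.le_mod_of_lt p hp (by omega) hlt) hd

theorem lt_of_small (h : HermiteFactorDegree n k) (hk : 4 ≤ k) (hev : Even k) (hkn : 2 * k ≤ n) :
    196 ≤ n ∧ (257 ≤ n ∨ k ≠ 4 ∧ k ≠ 6) := by
  by_contra hcon
  have hn : n < 257 := by omega
  have hn' : n < 196 ∨ k = 4 ∨ k = 6 := by omega
  have table : ∀ n < 257, ∀ j < n / 4 + 1, 2 ≤ j → (n < 196 ∨ j = 2 ∨ j = 3) →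
      [7, 11, 13, 17, 19, 23, 29, 31, 37, 41, 43, 53, 67, 89, 97].any fun p =>
        (2 * j + 1 < p ∧ n % p < 2 * j) ∨
        (n < p ^ 2 ∧ n % p < 2 * j % p ∧ (2 * j + 1) % p ≠ 0) := by
    decide +kernel
  obtain ⟨j, rfl⟩ := hev
  obtain ⟨p, hpL, hp⟩ := List.any_eq_true.1 (table n hn j (by omega) (by omega) (by omega))
  replace hp := of_decide_eq_true hp
  have hprime : p.Prime ∧ p ≠ 2 := by
    simp only [List.mem_cons, List.not_mem_nil, or_false] at hpL
    rcases hpL with rfl | rfl | rfl | rfl | rfl | rfl | rfl | rfl | rfl | rfl | rfl | rfl | rfl |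
      rfl | rfl <;> norm_num
  rw [two_mul] at hp
  rcases hp with ⟨h1, h2⟩ | ⟨h1, h2, h3⟩
  · have := h.le_mod_of_lt p hprime.1 hprime.2 h1
    omega
  · rcases h.mod_le_mod p hprime.1 hprime.2 h1 with h4 | h4
    · omega
    · exact h3 (Nat.mod_eq_zero_of_dvd h4)

theorem not_four (h : HermiteFactorDegree n 4) (hn : 8 ≤ n) : False := by
  have h1 := (h.lt_of_small le_rfl (by decide) hn).2
  have h2 := Nat.pow_le_pow_mul_choose (n := n) (k := 4) (by omega)
  have h3 := Nat.choose_le_pow_card (n := n) (k := 4) (by omega) (by omega) {2, 3, 5}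
    fun p hp hd => by
      have := h.le_add_one_of_dvd_choose (by norm_num) hp hd
      interval_cases p <;> first | decide | (revert hp; decide)
  have h4 : n ^ 3 * n ≤ n ^ 3 * 256 := by
    calc n ^ 3 * n = n ^ 4 := by ring
      _ ≤ 4 ^ 4 * n ^ 3 := h2.trans (Nat.mul_le_mul_left _ h3)
      _ = n ^ 3 * 256 := by ring
  have := Nat.le_of_mul_le_mul_left h4 (by positivity)
  omega

theorem not_six (h : HermiteFactorDegree n 6) (hn : 12 ≤ n) : False := by
  have h1 := (h.lt_of_small (by norm_num) (by decide) hn).2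
  have h2 := Nat.pow_le_pow_mul_choose (n := n) (k := 6) (by omega)
  have h3 := Nat.choose_le_pow_card (n := n) (k := 6) (by omega) (by omega) {2, 3, 5, 7}
    fun p hp hd => by
      have := h.le_add_one_of_dvd_choose (by norm_num) hp hd
      interval_cases p <;> first | decide | (revert hp; decide)
  have h4 : n ^ 4 * n ^ 2 ≤ n ^ 4 * 46656 := by
    calc n ^ 4 * n ^ 2 = n ^ 6 := by ring
      _ ≤ 6 ^ 6 * n ^ 4 := h2.trans (Nat.mul_le_mul_left _ h3)
      _ = n ^ 4 * 46656 := by ring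
  have := Nat.le_of_mul_le_mul_left h4 (by positivity)
  have : 257 ≤ n := by omega
  nlinarith

theorem eq_nine (h : HermiteFactorDegree n 2) (hn : 4 ≤ n) : n = 9 := by
  have hodd : ¬ Even n := fun hev => by
    obtain ⟨p, hp, hd⟩ := Nat.exists_prime_and_dvd (show n - 1 ≠ 1 by omega)
    obtain ⟨c, hc⟩ := hd
    obtain ⟨b, hb⟩ := hev
    have hp2 : p ≠ 2 := by rintro rfl; omega
    have hp2' := hp.two_le
    have h1 := h.le_mod_of_even ⟨b, hb⟩ p hp hp2 (by omega)
    rw [show n = 1 + p * c by omega, Nat.add_mul_mod_self_left, Nat.mod_eq_of_lt (by omega)] at h1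
    omega
  have hpr : ∀ p, p.Prime → p ∣ n ∨ p ∣ n - 1 → p = 2 ∨ p = 3 := fun p hp hd => by
    by_contra! hne
    have hp2 := hp.two_le
    have hp4 : p ≠ 4 := by rintro rfl; revert hp; decide
    have h1 := h.le_mod_of_lt p hp hne.1 (by omega)
    rcases hd with ⟨c, hc⟩ | ⟨c, hc⟩
    · rw [hc, Nat.mul_mod_right] at h1
      omega
    · rw [show n = 1 + p * c by omega, Nat.add_mul_mod_self_left, Nat.mod_eq_of_lt (by omega)] at h1
      omega
  rw [Nat.not_even_iff_odd] at hodd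
  obtain ⟨a, ha⟩ : ∃ a, n = 3 ^ a := by
    refine ⟨_, Nat.eq_prime_pow_of_unique_prime_dvd (by omega) fun {d} hd hdn => ?_⟩
    rcases hpr d hd (Or.inl hdn) with rfl | rfl
    · exact absurd (even_iff_two_dvd.2 hdn) (Nat.not_even_iff_odd.2 hodd)
    · rfl
  have ha2 : 2 ≤ a := by
    by_contra! hlt
    interval_cases a <;> omega
  obtain ⟨b, hb⟩ : ∃ b, n - 1 = 2 ^ b := by
    refine ⟨_, Nat.eq_prime_pow_of_unique_prime_dvd (by omega) fun {d} hd hdn => ?_⟩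
    rcases hpr d hd (Or.inr hdn) with rfl | rfl
    · rfl
    · have : 3 ∣ n := ha ▸ dvd_pow_self 3 (by omega)
      omega
  rcases lt_or_ge b 4 with hb4 | hb4
  · have h9 : 3 ^ 2 ≤ n := ha ▸ Nat.pow_le_pow_right (by norm_num) ha2
    interval_cases b <;> omega
  · obtain ⟨b, rfl⟩ := Nat.exists_eq_add_of_le hb4
    rw [pow_add] at hb
    obtain ⟨c, r, hr, rfl⟩ : ∃ c r, r < 4 ∧ a = 4 * c + r :=
      ⟨a / 4, a % 4, Nat.mod_lt _ (by norm_num), (Nat.div_add_mod a 4).symm⟩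
    have h80 : 3 ^ (4 * c) % 80 = 1 := by
      rw [pow_mul, Nat.pow_mod]
      norm_num
    rw [pow_add] at ha
    interval_cases r
    · have := hpr 5 (by norm_num) (Or.inr (by omega))
      omega
    all_goals omega

theorem eq_nine_and_eq_two (h : HermiteFactorDegree n k) (hk : 2 ≤ k) (hev : Even k)
    (hkn : 2 * k ≤ n) : n = 9 ∧ k = 2 := by
  obtain rfl | hk4 : k = 2 ∨ 4 ≤ k := by
    obtain ⟨j, hj⟩ := hev
    omega
  · exact ⟨h.eq_nine hkn, rfl⟩
  exfalso
  obtain rfl | rfl | hk8 : k = 4 ∨ k = 6 ∨ 8 ≤ k := by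
    obtain ⟨j, hj⟩ := hev
    omega
  · exact h.not_four hkn
  · exact h.not_six hkn
  rcases le_or_gt (k ^ 2) n with hsq | hsq
  · have hlt := Nat.pow_lt_choose_of_sq_le (e := Nat.primeCounting (k + 1)) hk hsq (by
      have := Nat.two_mul_primeCounting_le (s := k + 1) (by omega)
      obtain ⟨j, hj⟩ := hev
      omega)
    rw [← Nat.primesLE_card_eq_primeCounting] at hlt
    refine absurd hlt (not_lt.2 (Nat.choose_le_pow_card (by omega) (by omega) _ fun p hp hd => ?_))
    exact Nat.mem_primesLE.2 ⟨h.le_add_one_of_dvd_choose hk hp hd, hp⟩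
  · set s := Nat.sqrt n with hs
    have hn := (h.lt_of_small hk4 hev hkn).1
    have hs14 : 14 ≤ s := Nat.le_sqrt.2 (by omega)
    have hsk : s ≤ k := (Nat.sqrt_lt'.2 hsq).le
    have hsn : s ^ 2 ≤ n := Nat.sqrt_le' n
    have hns : n < (s + 1) ^ 2 := Nat.lt_succ_sqrt' n
    obtain ⟨q, hq⟩ : ∃ q, ∀ p, p.Prime → s < p → p ∣ k + 1 → p = q := by
      by_cases hex : ∃ q, q.Prime ∧ s < q ∧ q ∣ k + 1
      · obtain ⟨q, hqp, hsq', hqd⟩ := hex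
        refine ⟨q, fun p hp hsp hpd => ?_⟩
        by_contra hne
        have h1 := Nat.le_of_dvd (by omega)
          (((Nat.coprime_primes hp hqp).2 hne).mul_dvd_of_dvd_of_dvd hpd hqd)
        have h2 : (s + 1) * (s + 1) ≤ p * q := Nat.mul_le_mul hsp hsq'
        nlinarith
      · push Not at hex
        exact ⟨0, fun p hp hsp hpd => absurd hpd (hex p hp hsp)⟩
    have hlt := Nat.pow_lt_choose_of_sq_le (e := (insert q (Nat.primesLE s)).card)
      (by omega : 2 ≤ s) hsn (by
        have := Nat.two_mul_primeCounting_add_two_le hs14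
        have := Finset.card_insert_le q (Nat.primesLE s)
        rw [Nat.primesLE_card_eq_primeCounting] at this
        omega)
    refine absurd (hlt.trans_le (Nat.choose_le_choose_of_le_half hsk hkn)) (not_lt.2
      (Nat.choose_le_pow_card (by omega) (by omega) _ fun p hp hd => ?_))
    rcases le_or_gt p s with hps | hps
    · exact Finset.mem_insert_of_mem (Nat.mem_primesLE.2 ⟨hps, hp⟩)
    · have hnp : n < p ^ 2 := hns.trans_le (Nat.pow_le_pow_left hps 2)
      rcases h.mod_le_mod p hp (by omega) hnp with h1 | h1
      · exact absurd hd (hp.not_dvd_choose_of_mod_le_of_lt_sq h1 (by omega) hnp)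
      · exact Finset.mem_insert.2 (Or.inl (hq p hp hps h1))

end HermiteFactorDegree

/-- The coefficients of a product of linear factors over a nonarchimedean field, weighted by powers
of `ρ`, first attain their maximum at the number of roots of norm less than `ρ`. -/
theorem IsUltrametricDist.norm_coeff_prod_X_sub_C {K : Type*} [NormedField K] [IsUltrametricDist K]
    (S : Multiset K) {ρ : ℝ} (hρ : 0 < ρ) :
    ‖(S.map fun a => X - C a).prod.coeff (S.filter (‖·‖ < ρ)).card‖ =
      ((S.filter (¬ ‖·‖ < ρ)).map norm).prod ∧
    (∀ i < (S.filter (‖·‖ < ρ)).card, ‖(S.map fun a => X - C a).prod.coeff i‖ * ρ ^ i <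
      ((S.filter (¬ ‖·‖ < ρ)).map norm).prod * ρ ^ (S.filter (‖·‖ < ρ)).card) ∧
    ∀ i, ‖(S.map fun a => X - C a).prod.coeff i‖ * ρ ^ i ≤
      ((S.filter (¬ ‖·‖ < ρ)).map norm).prod * ρ ^ (S.filter (‖·‖ < ρ)).card := by
  induction S using Multiset.induction_on with
  | empty =>
    refine ⟨by simp, by simp, fun i => ?_⟩
    rcases i with _ | i
    · simp
    · simp [coeff_one]
  | cons a S ih =>
    obtain ⟨h1, h2, h3⟩ := ih
    have hM : 0 < ((S.filter (¬ ‖·‖ < ρ)).map norm).prod := by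
      refine Multiset.prod_pos fun x hx => ?_
      obtain ⟨b, hb, rfl⟩ := Multiset.mem_map.1 hx
      exact hρ.trans_le (not_lt.1 (Multiset.mem_filter.1 hb).2)
    rw [Multiset.map_cons, Multiset.prod_cons]
    generalize (S.map fun a => X - C a).prod = f at *
    have hsub (u v : K) : ‖u - v‖ ≤ max ‖u‖ ‖v‖ := by
      simpa [sub_eq_add_neg] using IsUltrametricDist.norm_add_le_max u (-v)
    have h0 : ((X - C a) * f).coeff 0 = - (a * f.coeff 0) := by simp [sub_mul]
    have hs : ∀ i, ((X - C a) * f).coeff (i + 1) = f.coeff i - a * f.coeff (i + 1) := fun i => by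
      rw [sub_mul, coeff_sub, coeff_X_mul, coeff_C_mul]
    by_cases ha : ‖a‖ < ρ
    · rw [Multiset.filter_cons_of_pos (p := fun x => ‖x‖ < ρ) _ ha,
        Multiset.filter_cons_of_neg (p := fun x => ¬ ‖x‖ < ρ) _ (not_not.2 ha),
        Multiset.card_cons]
      generalize ((S.filter (¬ ‖·‖ < ρ)).map norm).prod = M at *
      generalize (S.filter (‖·‖ < ρ)).card = t at *
      have key : ∀ i, ‖a * f.coeff i‖ * ρ ^ i < M * ρ ^ (t + 1) := fun i => by
        rw [norm_mul, mul_assoc]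
        calc ‖a‖ * (‖f.coeff i‖ * ρ ^ i) ≤ ‖a‖ * (M * ρ ^ t) :=
            mul_le_mul_of_nonneg_left (h3 i) (by positivity)
          _ < ρ * (M * ρ ^ t) := by gcongr
          _ = M * ρ ^ (t + 1) := by ring
      refine ⟨?_, fun i hi => ?_, fun i => ?_⟩
      · have h5 := lt_of_mul_lt_mul_right (key (t + 1)) (by positivity)
        rw [hs, sub_eq_add_neg, IsUltrametricDist.norm_add_eq_max_of_norm_ne_norm, norm_neg, h1]
        · exact max_eq_left h5.le
        · rw [norm_neg, h1]
          exact h5.ne'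
      · rcases i with _ | i
        · rw [h0, norm_neg]
          exact key 0
        · rw [hs]
          calc _ ≤ max ‖f.coeff i‖ ‖a * f.coeff (i + 1)‖ * ρ ^ (i + 1) := by
                gcongr
                exact hsub _ _
            _ < M * ρ ^ (t + 1) := by
                rw [max_mul_of_nonneg _ _ (by positivity)]
                refine max_lt ?_ (key _)
                rw [pow_succ, pow_succ, ← mul_assoc, ← mul_assoc]
                exact mul_lt_mul_of_pos_right (h2 i (by omega)) hρ
      · rcases i with _ | i
        · rw [h0, norm_neg]
          exact (key 0).le
        · rw [hs]
          calc _ ≤ max ‖f.coeff i‖ ‖a * f.coeff (i + 1)‖ * ρ ^ (i + 1) := by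
                gcongr
                exact hsub _ _
            _ ≤ M * ρ ^ (t + 1) := by
                rw [max_mul_of_nonneg _ _ (by positivity)]
                refine max_le ?_ (key _).le
                rw [pow_succ, pow_succ, ← mul_assoc, ← mul_assoc]
                exact mul_le_mul_of_nonneg_right (h3 i) hρ.le
    · rw [Multiset.filter_cons_of_neg (p := fun x => ‖x‖ < ρ) _ ha,
        Multiset.filter_cons_of_pos (p := fun x => ¬ ‖x‖ < ρ) _ ha,
        Multiset.map_cons, Multiset.prod_cons]
      generalize ((S.filter (¬ ‖·‖ < ρ)).map norm).prod = M at *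
      generalize (S.filter (‖·‖ < ρ)).card = t at *
      rw [not_lt] at ha
      have ha0 : 0 < ‖a‖ := hρ.trans_le ha
      have key : ∀ i, ‖a * f.coeff i‖ * ρ ^ i ≤ ‖a‖ * M * ρ ^ t := fun i => by
        rw [norm_mul, mul_assoc, mul_assoc]
        exact mul_le_mul_of_nonneg_left (h3 i) (by positivity)
      have key' : ∀ i < t, ‖a * f.coeff i‖ * ρ ^ i < ‖a‖ * M * ρ ^ t := fun i hi => by
        rw [norm_mul, mul_assoc, mul_assoc]
        exact mul_lt_mul_of_pos_left (h2 i hi) ha0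
      refine ⟨?_, fun i hi => ?_, fun i => ?_⟩
      · rcases t with _ | t
        · rw [h0, norm_neg, norm_mul, h1]
        · have h5 : ‖f.coeff t‖ < ‖a * f.coeff (t + 1)‖ := by
            rw [norm_mul, h1]
            have := h2 t (by omega)
            rw [pow_succ, mul_comm _ ρ, ← mul_assoc] at this
            calc _ < M * ρ := lt_of_mul_lt_mul_right this (by positivity)
              _ ≤ M * ‖a‖ := by gcongr
              _ = _ := mul_comm _ _
          rw [hs, sub_eq_add_neg, IsUltrametricDist.norm_add_eq_max_of_norm_ne_norm, norm_neg]
          · rw [max_eq_right h5.le, norm_mul, h1]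
          · rw [norm_neg]
            exact h5.ne
      · rcases i with _ | i
        · rw [h0, norm_neg]
          exact key' 0 hi
        · rw [hs]
          calc _ ≤ max ‖f.coeff i‖ ‖a * f.coeff (i + 1)‖ * ρ ^ (i + 1) := by
                gcongr
                exact hsub _ _
            _ < ‖a‖ * M * ρ ^ t := by
                rw [max_mul_of_nonneg _ _ (by positivity)]
                refine max_lt ?_ (key' _ hi)
                calc _ = ρ * (‖f.coeff i‖ * ρ ^ i) := by ring
                  _ < ρ * (M * ρ ^ t) := mul_lt_mul_of_pos_left (h2 i (by omega)) hρ
                  _ ≤ ‖a‖ * (M * ρ ^ t) := by gcongr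
                  _ = _ := by ring
      · rcases i with _ | i
        · rw [h0, norm_neg]
          exact key 0
        · rw [hs]
          calc _ ≤ max ‖f.coeff i‖ ‖a * f.coeff (i + 1)‖ * ρ ^ (i + 1) := by
                gcongr
                exact hsub _ _
            _ ≤ ‖a‖ * M * ρ ^ t := by
                rw [max_mul_of_nonneg _ _ (by positivity)]
                refine max_le ?_ (key _)
                calc _ = ρ * (‖f.coeff i‖ * ρ ^ i) := by ring
                  _ ≤ ρ * (M * ρ ^ t) :=
            mul_le_mul_of_nonneg_left (h3 i) (by positivity)
                  _ ≤ ‖a‖ * (M * ρ ^ t) := by gcongr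
                  _ = _ := by ring

/-- At a root of a polynomial over a nonarchimedean field, no term strictly dominates. -/
theorem IsUltrametricDist.exists_norm_term_le {K : Type*} [NormedField K] [IsUltrametricDist K]
    {f : K[X]} {x : K} (hx : f.IsRoot x) {i : ℕ} (hi : f.coeff i * x ^ i ≠ 0) :
    ∃ j ≠ i, f.coeff j * x ^ j ≠ 0 ∧ ‖f.coeff i * x ^ i‖ ≤ ‖f.coeff j * x ^ j‖ := by
  have hmem : i ∈ Finset.range (f.natDegree + 1) := by
    by_contra h
    rw [Finset.mem_range, not_lt] at h
    exact hi (by rw [coeff_eq_zero_of_natDegree_lt (by omega), zero_mul])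
  have hsum : f.eval x = 0 := hx
  rw [eval_eq_sum_range, ← Finset.add_sum_erase _ _ hmem] at hsum
  have hne : ((Finset.range (f.natDegree + 1)).erase i).Nonempty := by
    by_contra h
    rw [Finset.not_nonempty_iff_eq_empty] at h
    rw [h, Finset.sum_empty, add_zero] at hsum
    exact hi hsum
  obtain ⟨j, hj, hle⟩ := IsUltrametricDist.exists_norm_finsetSum_le_of_nonempty hne
    fun j => f.coeff j * x ^ j
  have hle' : ‖f.coeff i * x ^ i‖ ≤ ‖f.coeff j * x ^ j‖ := by
    rwa [eq_neg_of_add_eq_zero_left hsum, norm_neg]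
  exact ⟨j, Finset.ne_of_mem_erase hj,
    norm_pos_iff.1 ((norm_pos_iff.2 hi).trans_le hle'), hle'⟩

theorem PadicAlgCl.norm_intCast (p : ℕ) [Fact p.Prime] {a : ℤ} (ha : a ≠ 0) :
    ‖(a : PadicAlgCl p)‖ = (p : ℝ) ^ (-(padicValInt p a : ℝ)) := by
  have h : (a : PadicAlgCl p) = ((a : ℚ_[p]) : PadicAlgCl p) :=
    (map_intCast (algebraMap ℚ_[p] (PadicAlgCl p)) a).symm
  rw [h, PadicAlgCl.norm_extends, Padic.norm_eq_zpow_neg_valuation (by exact_mod_cast ha),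
    Padic.valuation_intCast, ← Real.rpow_intCast]
  simp

theorem PadicAlgCl.exists_norm_ratCast (p : ℕ) [Fact p.Prime] {a : ℚ} (ha : a ≠ 0) :
    ∃ z : ℤ, ‖(a : PadicAlgCl p)‖ = (p : ℝ) ^ (-(z : ℝ)) := by
  have h : (a : PadicAlgCl p) = ((a : ℚ_[p]) : PadicAlgCl p) :=
    (map_ratCast (algebraMap ℚ_[p] (PadicAlgCl p)) a).symm
  rw [h, PadicAlgCl.norm_extends, Padic.norm_eq_zpow_neg_valuation (by exact_mod_cast ha)]
  exact ⟨_, by rw [← Real.rpow_intCast]; push_cast; rfl⟩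

theorem Multiset.prod_map_norm_eq_rpow {K : Type*} [NormedField K] {b : ℝ} (hb : 1 < b)
    (S : Multiset K) (hS : ∀ a ∈ S, a ≠ 0) :
    (S.map norm).prod = b ^ (-(S.map fun a => -Real.logb b ‖a‖).sum) := by
  induction S using Multiset.induction_on with
  | empty => simp
  | cons a S ih =>
    rw [Multiset.map_cons, Multiset.prod_cons, ih fun c hc => hS c (Multiset.mem_cons_of_mem hc),
      Multiset.map_cons, Multiset.sum_cons, neg_add, Real.rpow_add (by linarith), neg_neg,
      Real.rpow_logb (by linarith) hb.ne' (norm_pos_iff.2 (hS a (Multiset.mem_cons_self a S)))]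

/-- The slopes `T` of the `p`-adic Newton polygon of a monic integer polynomial, together with the
slopes `S` of a monic rational factor. -/
theorem Polynomial.exists_newton_slopes (p : ℕ) [Fact p.Prime] {F : ℤ[X]} (hF : F.Monic)
    (hF0 : F.coeff 0 ≠ 0) {g : ℚ[X]} (hg : g.Monic) (hgF : g ∣ F.map (Int.castRingHom ℚ)) :
    ∃ S T : Multiset ℝ, S ≤ T ∧ S.card = g.natDegree ∧ T.card = F.natDegree ∧
      (∃ z : ℤ, S.sum = z) ∧ (∀ V ∈ T, 0 ≤ V) ∧
      (∀ c : ℝ, F.coeff (T.filter (c < ·)).card ≠ 0 ∧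
        (padicValInt p (F.coeff (T.filter (c < ·)).card) : ℝ) = (T.filter (¬ c < ·)).sum) ∧
      ∀ V ∈ T, ∀ i, F.coeff i ≠ 0 → ∃ j ≠ i, F.coeff j ≠ 0 ∧
        padicValInt p (F.coeff j) + j * V ≤ padicValInt p (F.coeff i) + i * V := by
  have hp1 : (1 : ℝ) < p := by exact_mod_cast (Fact.out : p.Prime).one_lt
  have hp0 : (0 : ℝ) < p := by linarith
  set f : (PadicAlgCl p)[X] := F.map (Int.castRingHom _) with hf
  set h : (PadicAlgCl p)[X] := g.map (algebraMap ℚ _) with hh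
  have hfm : f.Monic := hF.map _
  have hhm : h.Monic := hg.map _
  have hhf : h ∣ f := by
    have := Polynomial.map_dvd (algebraMap ℚ (PadicAlgCl p)) hgF
    rwa [Polynomial.map_map, RingHom.ext_int (RingHom.comp _ _) (Int.castRingHom _)] at this
  have hcoeff (i : ℕ) : f.coeff i = (F.coeff i : PadicAlgCl p) := by simp [hf]
  have hf0 : f.coeff 0 ≠ 0 := by rw [hcoeff]; exact_mod_cast hF0
  have hfs : f.Splits := IsAlgClosed.splits f
  have hhs : h.Splits := IsAlgClosed.splits h
  have hle : h.roots ≤ f.roots := Polynomial.roots.le_of_dvd hfm.ne_zero hhf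
  have hne (a) (ha : a ∈ f.roots) : a ≠ 0 := by
    rintro rfl
    exact hf0 (by simpa [coeff_zero_eq_eval_zero] using (mem_roots'.1 ha).2)
  have hterm (a) (ha : a ∈ f.roots) (i : ℕ) (hi : F.coeff i ≠ 0) :
      ‖f.coeff i * a ^ i‖ =
        (p : ℝ) ^ (-(padicValInt p (F.coeff i) + i * (-Real.logb p ‖a‖))) := by
    rw [norm_mul, hcoeff, PadicAlgCl.norm_intCast p hi, neg_add, Real.rpow_add hp0, norm_pow]
    congr 1
    rw [← mul_neg, neg_neg, mul_comm, Real.rpow_mul hp0.le,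
      Real.rpow_logb hp0 hp1.ne' (norm_pos_iff.2 (hne a ha)), Real.rpow_natCast]
  have hU (a) (ha : a ∈ f.roots) (i : ℕ) (hi : F.coeff i ≠ 0) : ∃ j ≠ i, F.coeff j ≠ 0 ∧
      padicValInt p (F.coeff j) + j * (-Real.logb p ‖a‖) ≤
        padicValInt p (F.coeff i) + i * (-Real.logb p ‖a‖) := by
    have hi' : f.coeff i * a ^ i ≠ 0 :=
      mul_ne_zero (by rw [hcoeff]; exact_mod_cast hi) (pow_ne_zero _ (hne a ha))
    obtain ⟨j, hji, hj0, hj⟩ := IsUltrametricDist.exists_norm_term_le (mem_roots'.1 ha).2 hi'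
    have hj1 : F.coeff j ≠ 0 := by
      intro h0
      rw [hcoeff, h0, Int.cast_zero, zero_mul] at hj0
      exact hj0 rfl
    rw [hterm a ha i hi, hterm a ha j hj1, Real.rpow_le_rpow_left_iff hp1, neg_le_neg_iff] at hj
    exact ⟨j, hji, hj1, hj⟩
  refine ⟨h.roots.map fun a => -Real.logb p ‖a‖, f.roots.map fun a => -Real.logb p ‖a‖,
    Multiset.map_le_map hle, ?_, ?_, ?_, ?_, fun c => ?_, ?_⟩
  · rw [Multiset.card_map, ← hhs.natDegree_eq_card_roots, hh, hg.natDegree_map]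
  · rw [Multiset.card_map, ← hfs.natDegree_eq_card_roots, hf, hF.natDegree_map]
  · have hg0 : g.coeff 0 ≠ 0 := by
      intro h0
      rw [coeff_zero_eq_eval_zero] at h0
      have h1 := (IsRoot.dvd (show g.IsRoot 0 from h0) hgF)
      rw [IsRoot, ← coeff_zero_eq_eval_zero, coeff_map] at h1
      exact hF0 (by simpa using h1)
    obtain ⟨z, hz⟩ := PadicAlgCl.exists_norm_ratCast p hg0
    refine ⟨z, ?_⟩
    have h1 := congrArg norm (hhs.coeff_zero_eq_prod_roots_of_monic hhm)
    have h2 : ‖h.roots.prod‖ = (h.roots.map norm).prod :=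
      map_multiset_prod (normHom (α := PadicAlgCl p)) _
    rw [norm_mul, norm_pow, norm_neg, norm_one, one_pow, one_mul, h2, hh, coeff_map, ← hh,
      Multiset.prod_map_norm_eq_rpow hp1 _ fun a ha => hne a (Multiset.mem_of_le hle ha)] at h1
    rw [eq_ratCast, hz] at h1
    have := (Real.rpow_right_inj hp0 hp1.ne').1 h1
    linarith
  · intro V hV
    obtain ⟨a, ha, rfl⟩ := Multiset.mem_map.1 hV
    obtain ⟨j, hjN, hj0, hj⟩ := hU a ha F.natDegree (by rw [hF.coeff_natDegree]; exact one_ne_zero)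
    rw [hF.coeff_natDegree, padicValInt.one] at hj
    have hj2 : j < F.natDegree := lt_of_le_of_ne (le_natDegree_of_ne_zero hj0) hjN
    have hj3 : (j : ℝ) < F.natDegree := by exact_mod_cast hj2
    have : (0 : ℝ) ≤ padicValInt p (F.coeff j) := by positivity
    push_cast at hj
    by_contra hneg
    nlinarith
  · have hρ : (0 : ℝ) < (p : ℝ) ^ (-c) := Real.rpow_pos_of_pos hp0 _
    have key (a) (ha : a ∈ f.roots) : c < -Real.logb p ‖a‖ ↔ ‖a‖ < (p : ℝ) ^ (-c) := by
      rw [lt_neg, Real.logb_lt_iff_lt_rpow hp1 (norm_pos_iff.2 (hne a ha))]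
    obtain ⟨h1, -, -⟩ := IsUltrametricDist.norm_coeff_prod_X_sub_C f.roots hρ
    rw [← hfs.eq_prod_roots_of_monic hfm, Multiset.prod_map_norm_eq_rpow hp1 _
      fun a ha => hne a (Multiset.mem_of_mem_filter ha)] at h1
    rw [Multiset.filter_map, Multiset.filter_map, Multiset.card_map]
    have e1 : f.roots.filter ((c < ·) ∘ fun a => -Real.logb p ‖a‖) =
        f.roots.filter (‖·‖ < (p : ℝ) ^ (-c)) := Multiset.filter_congr fun a ha => key a ha
    have e2 : f.roots.filter ((¬ c < ·) ∘ fun a => -Real.logb p ‖a‖) =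
        f.roots.filter (¬ ‖·‖ < (p : ℝ) ^ (-c)) :=
      Multiset.filter_congr fun a ha => not_congr (key a ha)
    rw [e1, e2]
    generalize (f.roots.filter (‖·‖ < (p : ℝ) ^ (-c))).card = t at *
    have h2 : F.coeff t ≠ 0 := by
      intro h0
      rw [hcoeff, h0, Int.cast_zero, norm_zero] at h1
      exact (Real.rpow_pos_of_pos hp0 _).ne h1
    refine ⟨h2, ?_⟩
    rw [hcoeff, PadicAlgCl.norm_intCast p h2] at h1
    have := (Real.rpow_right_inj hp0 hp1.ne').1 h1
    linarith
  · intro V hV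
    obtain ⟨a, ha, rfl⟩ := Multiset.mem_map.1 hV
    exact hU a ha

namespace Polynomial

/-- The polynomial `F` with `hermite n = X ^ (n % 2) * F(X ^ 2)`. -/
noncomputable def hermiteReduced (n : ℕ) : ℤ[X] :=
  ∑ j ∈ Finset.range (n / 2 + 1), monomial j ((hermite n).coeff (2 * j + n % 2))

theorem coeff_hermiteReduced (n j : ℕ) :
    (hermiteReduced n).coeff j = (hermite n).coeff (2 * j + n % 2) := by
  simp only [hermiteReduced, finsetSum_coeff, coeff_monomial, Finset.sum_ite_eq',
    Finset.mem_range]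
  split_ifs with h
  · rfl
  · exact (coeff_hermite_of_lt (by omega)).symm

theorem coeff_hermiteReduced_half (n : ℕ) : (hermiteReduced n).coeff (n / 2) = 1 := by
  rw [coeff_hermiteReduced, Nat.div_add_mod, coeff_hermite_self]

theorem natDegree_hermiteReduced (n : ℕ) : (hermiteReduced n).natDegree = n / 2 := by
  refine natDegree_eq_of_le_of_coeff_ne_zero (natDegree_le_iff_coeff_eq_zero.2 fun j hj => ?_)
    (by rw [coeff_hermiteReduced_half]; exact one_ne_zero)
  rw [coeff_hermiteReduced]
  exact coeff_hermite_of_lt (by omega)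

theorem monic_hermiteReduced (n : ℕ) : (hermiteReduced n).Monic := by
  rw [Monic, leadingCoeff, natDegree_hermiteReduced, coeff_hermiteReduced_half]

theorem hermite_eq_X_pow_mul_expand (n : ℕ) :
    hermite n = X ^ (n % 2) * expand ℤ 2 (hermiteReduced n) := by
  ext i
  rw [coeff_X_pow_mul', coeff_expand two_pos]
  split_ifs with h1 h2
  · rw [coeff_hermiteReduced]
    congr 1
    omega
  · exact coeff_hermite_of_odd_add (Nat.odd_iff.2 (by omega))
  · exact coeff_hermite_of_odd_add (Nat.odd_iff.2 (by omega))

theorem natAbs_coeff_hermiteReduced_mul {n j : ℕ} (hj : j ≤ n / 2) :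
    ((hermiteReduced n).coeff j).natAbs *
      (2 ^ (n / 2 - j) * (n / 2 - j).factorial * (2 * j + n % 2).factorial) = n.factorial := by
  have h1 : n - (2 * j + n % 2) = 2 * (n / 2 - j) := by omega
  rw [coeff_hermiteReduced, coeff_hermite, if_pos (Nat.even_iff.2 (by omega)), h1,
    Int.natAbs_mul, Int.natAbs_mul, Int.natAbs_pow, Int.natAbs_neg, Int.natAbs_one, one_pow,
    one_mul, Int.natAbs_natCast, Int.natAbs_natCast,
    ← Nat.choose_mul_factorial_mul_factorial (show 2 * j + n % 2 ≤ n by omega), h1]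
  have h2 : (2 * (n / 2 - j)).factorial =
      (2 * (n / 2 - j) - 1).doubleFactorial * (2 ^ (n / 2 - j) * (n / 2 - j).factorial) := by
    rw [← Nat.doubleFactorial_two_mul]
    rcases Nat.eq_zero_or_pos (n / 2 - j) with h | h
    · simp [h]
    · obtain ⟨m, hm⟩ : ∃ m, 2 * (n / 2 - j) = m + 1 := ⟨2 * (n / 2 - j) - 1, by omega⟩
      rw [hm, Nat.factorial_eq_mul_doubleFactorial, Nat.add_sub_cancel, mul_comm]
  rw [h2]
  ring

theorem coeff_hermiteReduced_ne_zero {n j : ℕ} (hj : j ≤ n / 2) :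
    (hermiteReduced n).coeff j ≠ 0 := by
  intro h
  have := natAbs_coeff_hermiteReduced_mul hj
  rw [h, Int.natAbs_zero, zero_mul] at this
  exact n.factorial_ne_zero this.symm

theorem padicValInt_coeff_hermiteReduced {p : ℕ} [Fact p.Prime] (hp : p ≠ 2) {n j : ℕ}
    (hj : j ≤ n / 2) :
    padicValInt p ((hermiteReduced n).coeff j) + padicValNat p (n / 2 - j).factorial +
      padicValNat p (2 * j + n % 2).factorial = padicValNat p n.factorial := by
  have h0 := coeff_hermiteReduced_ne_zero hj
  rw [← natAbs_coeff_hermiteReduced_mul hj, padicValNat.mul (Int.natAbs_ne_zero.2 h0)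
    (by positivity), padicValNat.mul (by positivity) (by positivity),
    padicValNat.mul (by positivity) (by positivity), padicValNat.pow,
    padicValNat_primes hp, padicValInt]
  ring

end Polynomial

theorem padicValNat_factorial_mono (p : ℕ) [Fact p.Prime] {m n : ℕ} (h : m ≤ n) :
    padicValNat p m.factorial ≤ padicValNat p n.factorial :=
  (padicValNat_dvd_iff_le n.factorial_ne_zero).1
    (pow_padicValNat_dvd.trans (Nat.factorial_dvd_factorial h))

theorem padicValNat_factorial_of_lt_sq {p : ℕ} [Fact p.Prime] {m : ℕ} (h : m < p ^ 2) :
    padicValNat p m.factorial = m / p := by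
  rw [padicValNat_factorial (Nat.log_lt_of_lt_pow' two_ne_zero h)]
  simp

theorem padicValNat_factorial_lt_two_mul {p : ℕ} [Fact p.Prime] {m : ℕ} (h : p ≤ 2 * m) :
    padicValNat p m.factorial < padicValNat p (2 * m).factorial := by
  have hp : p.Prime := Fact.out
  have hr := Nat.mod_lt (2 * m) hp.pos
  have hd := Nat.div_add_mod (2 * m) p
  have hpos : 0 < 2 * m / p := Nat.div_pos h hp.pos
  have hpd : p ≤ p * (2 * m / p) := Nat.le_mul_of_pos_right _ hpos
  obtain ⟨c, hc⟩ : ∃ c, p * (2 * m / p) = c + 1 := ⟨p * (2 * m / p) - 1, by omega⟩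
  have hmc : m ≤ c := by omega
  calc padicValNat p m.factorial ≤ padicValNat p c.factorial := padicValNat_factorial_mono p hmc
    _ < padicValNat p (c + 1).factorial := by
      rw [Nat.factorial_succ, padicValNat.mul (by omega) c.factorial_ne_zero]
      have := one_le_padicValNat_of_dvd (p := p) (n := c + 1) (by omega) (hc ▸ dvd_mul_right _ _)
      omega
    _ ≤ _ := padicValNat_factorial_mono p (by omega)

namespace Polynomial

variable {p : ℕ} [Fact p.Prime] {n : ℕ}

theorem two_mul_sub_le_mod_of_padicValInt_eq_zero (hp : p ≠ 2) {t : ℕ} (ht : t ≤ n / 2)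
    (h : padicValInt p ((hermiteReduced n).coeff t) = 0) : 2 * (n / 2 - t) ≤ n % p := by
  have hv := padicValInt_coeff_hermiteReduced (p := p) hp ht
  have h1 : 2 * t + n % 2 = n - 2 * (n / 2 - t) := by omega
  rw [h, zero_add, h1] at hv
  generalize hu : n / 2 - t = u at *
  have hun : 2 * u ≤ n := by omega
  have hC := (Nat.choose_pos hun).ne'
  rw [← Nat.choose_mul_factorial_mul_factorial hun,
    padicValNat.mul (mul_ne_zero hC (Nat.factorial_ne_zero _)) (Nat.factorial_ne_zero _),
    padicValNat.mul hC (Nat.factorial_ne_zero _)] at hv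
  have h2 := padicValNat_factorial_mono p (show u ≤ 2 * u by omega)
  have hup : 2 * u < p := by
    by_contra hle
    have := padicValNat_factorial_lt_two_mul (not_lt.1 hle)
    omega
  by_contra hlt
  have hdvd : p ∣ n.choose (2 * u) := by
    refine (Nat.modEq_zero_iff_dvd).1 ((Choose.choose_modEq_choose_mod_mul_choose_div_nat).trans ?_)
    rw [Nat.mod_eq_of_lt hup, Nat.choose_eq_zero_of_lt (by omega), zero_mul]
  have := one_le_padicValNat_of_dvd hC hdvd
  omega

/-- Every slope of the Newton polygon of `hermiteReduced n` at an odd prime `p` is at most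
`2 / (p - 1)`, and even smaller when `n` is even. -/
theorem hermiteReduced_slope_le (hp : p ≠ 2) {V : ℝ} {j : ℕ} (hj0 : j ≠ 0) (hj : j ≤ n / 2)
    (h : padicValInt p ((hermiteReduced n).coeff j) + j * V ≤
      padicValInt p ((hermiteReduced n).coeff 0)) :
    (p - 1) * V ≤ 2 ∧ (Even n → (p - 1) * V < 2) := by
  have hp1 : 1 ≤ p := (Fact.out : p.Prime).one_le
  have hv := padicValInt_coeff_hermiteReduced (p := p) hp hj
  have hv0 := padicValInt_coeff_hermiteReduced (p := p) hp (Nat.zero_le (n / 2))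
  have h1 := padicValNat_factorial_mono p (show n / 2 - j ≤ n / 2 - 0 by omega)
  have h2 := sub_one_mul_padicValNat_factorial_lt_of_ne_zero p (show 2 * j + n % 2 ≠ 0 by omega)
  have h3 : padicValInt p ((hermiteReduced n).coeff 0) ≤
      padicValInt p ((hermiteReduced n).coeff j) + padicValNat p (2 * j + n % 2).factorial := by
    omega
  have h4 : j * V ≤ padicValNat p (2 * j + n % 2).factorial := by
    have : ((padicValInt p ((hermiteReduced n).coeff 0) : ℕ) : ℝ) ≤
      padicValInt p ((hermiteReduced n).coeff j) + padicValNat p (2 * j + n % 2).factorial := by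
      exact_mod_cast h3
    linarith
  have h5 : ((p : ℝ) - 1) * padicValNat p (2 * j + n % 2).factorial + 1 ≤ 2 * j + (n % 2 : ℕ) := by
    have := Nat.succ_le_of_lt h2
    rw [Nat.succ_eq_add_one] at this
    exact_mod_cast this
  have hp' : (0 : ℝ) ≤ (p : ℝ) - 1 := by
    have : (1 : ℝ) ≤ p := by exact_mod_cast hp1
    linarith
  have hj' : (0 : ℝ) < j := by exact_mod_cast Nat.pos_of_ne_zero hj0
  have h6 : j * ((p - 1) * V) + 1 ≤ 2 * j + (n % 2 : ℕ) := by
    have := mul_le_mul_of_nonneg_left h4 hp'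
    linarith
  have h7 : ((n % 2 : ℕ) : ℝ) ≤ 1 := by exact_mod_cast (show n % 2 ≤ 1 by omega)
  refine ⟨?_, fun hn => ?_⟩
  · by_contra hlt
    nlinarith
  · rw [Nat.even_iff.1 hn] at h6
    by_contra hlt
    push_cast at h6
    nlinarith

/-- The Newton polygon data of `hermiteReduced n` and of a factor `g` at an odd prime `p`. -/
theorem exists_newton_slopes_hermiteReduced (hp : p ≠ 2) {g : ℚ[X]} (hg : g.Monic)
    (hgF : g ∣ (hermiteReduced n).map (Int.castRingHom ℚ)) :
    ∃ S T : Multiset ℝ, S ≤ T ∧ S.card = g.natDegree ∧ (∃ z : ℤ, S.sum = z) ∧ (∀ V ∈ T, 0 ≤ V) ∧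
      2 * T.count 0 ≤ n % p ∧
      (∀ c : ℝ, (T.filter (c < ·)).card ≤ n / 2 ∧
        (padicValInt p ((hermiteReduced n).coeff (T.filter (c < ·)).card) : ℝ) =
          (T.filter (¬ c < ·)).sum) ∧
      ∀ V ∈ T, ∀ i ≤ n / 2, ∃ j ≠ i, j ≤ n / 2 ∧
        padicValInt p ((hermiteReduced n).coeff j) + j * V ≤
          padicValInt p ((hermiteReduced n).coeff i) + i * V := by
  obtain ⟨S, T, hST, hS, hT, hz, h0, hN, hU⟩ := exists_newton_slopes p (monic_hermiteReduced n)
    (coeff_hermiteReduced_ne_zero (Nat.zero_le _)) hg hgF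
  rw [natDegree_hermiteReduced] at hT
  have hle (c : ℝ) : (T.filter (c < ·)).card ≤ n / 2 :=
    hT ▸ Multiset.card_le_card (Multiset.filter_le _ _)
  refine ⟨S, T, hST, hS, hz, h0, ?_, fun c => ⟨hle c, (hN c).2⟩, fun V hV i hi => ?_⟩
  · have hf : T.filter (¬ (0 : ℝ) < ·) = T.filter (0 = ·) :=
      Multiset.filter_congr fun V hV => by
        rw [not_lt]
        exact ⟨fun h => (h0 V hV).antisymm h, fun h => h.ge⟩
    have hval : padicValInt p ((hermiteReduced n).coeff (T.filter ((0 : ℝ) < ·)).card) = 0 := by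
      have := (hN 0).2
      rw [hf, Multiset.filter_eq, Multiset.sum_replicate, smul_zero] at this
      exact_mod_cast this
    have hc : (T.filter ((0 : ℝ) < ·)).card + T.count 0 = n / 2 := by
      rw [Multiset.count_eq_card_filter_eq, ← hf, ← Multiset.card_add, Multiset.filter_add_not, hT]
    have := two_mul_sub_le_mod_of_padicValInt_eq_zero hp (hle 0) hval
    omega
  · obtain ⟨j, hji, hj0, hj⟩ := hU V hV i (coeff_hermiteReduced_ne_zero hi)
    exact ⟨j, hji, (natDegree_hermiteReduced n) ▸ le_natDegree_of_ne_zero hj0, hj⟩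

theorem two_mul_natDegree_le_mod (hp : p ≠ 2) {g : ℚ[X]} (hg : g.Monic)
    (hgF : g ∣ (hermiteReduced n).map (Int.castRingHom ℚ)) (hd : g.natDegree ≠ 0)
    (h : 2 * g.natDegree + 1 < p ∨ Even n ∧ 2 * g.natDegree < p) :
    2 * g.natDegree ≤ n % p := by
  obtain ⟨S, T, hST, hS, ⟨z, hz⟩, h0, hunit, -, hU⟩ := exists_newton_slopes_hermiteReduced hp hg hgF
  have hd0 : (0 : ℝ) < g.natDegree := by exact_mod_cast Nat.pos_of_ne_zero hd
  have hsmall (V : ℝ) (hV : V ∈ S) : V < 1 / g.natDegree := by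
    have hVT := Multiset.mem_of_le hST hV
    rw [lt_div_iff₀ hd0]
    obtain ⟨j, hj0, hj, hle⟩ := hU V hVT 0 (Nat.zero_le _)
    obtain ⟨h1, h2⟩ := hermiteReduced_slope_le hp hj0 hj (by simpa using hle)
    have h3 := h0 V hVT
    rcases h with h | ⟨hev, h⟩
    · have : (2 * g.natDegree + 1 + 1 : ℝ) ≤ p := by exact_mod_cast h
      nlinarith
    · have h4 := h2 hev
      have : (2 * g.natDegree + 1 : ℝ) ≤ p := by exact_mod_cast h
      nlinarith
  have hSne : S ≠ ∅ := by
    rintro rfl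
    exact hd (by simpa using hS.symm)
  have hlt : S.sum < 1 := by
    have := Multiset.sum_lt_sum_of_nonempty hSne (f := id) (g := fun _ => 1 / (g.natDegree : ℝ))
      hsmall
    rw [Multiset.map_id, Multiset.map_const', Multiset.sum_replicate, hS, nsmul_eq_mul,
      mul_one_div_cancel hd0.ne'] at this
    exact this
  have hge : 0 ≤ S.sum := Multiset.sum_nonneg fun V hV => h0 V (Multiset.mem_of_le hST hV)
  have hz0 : S.sum = 0 := by
    rw [hz] at hlt hge ⊢
    have h1 : z < 1 := by exact_mod_cast hlt
    have h2 : 0 ≤ z := by exact_mod_cast hge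
    rw [show z = 0 by omega, Int.cast_zero]
  have hall := Multiset.all_zero_of_le_zero_le_of_sum_eq_zero
    (fun V hV => h0 V (Multiset.mem_of_le hST hV)) hz0
  have hcount : S.count 0 = S.card := Multiset.count_eq_card.2 fun V hV => (hall V hV).symm
  have := Multiset.count_le_of_le 0 hST
  omega

/-- For `n < p ^ 2`, the valuations of the coefficients of `hermiteReduced n` in terms of base `p`
digits. -/
theorem padicValInt_coeff_hermiteReduced_of_lt_sq (hp : p ≠ 2) (hn : n < p ^ 2) {i w : ℕ}
    (hj : p * i + w ≤ n / 2) (hw : w < p) :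
    padicValInt p ((hermiteReduced n).coeff (p * i + w)) + i +
      (if (p + 1) / 2 - n % 2 ≤ w then 1 else 0) =
    n / 2 / p + (if (p + 1) / 2 - n % 2 ≤ n / 2 % p then 1 else 0) +
      (if n / 2 % p < w then 1 else 0) := by
  have hpr : p.Prime := Fact.out
  have hp0 := hpr.pos
  have hodd : p % 2 = 1 := hpr.eq_two_or_odd.resolve_left hp
  have hv := padicValInt_coeff_hermiteReduced (p := p) hp hj
  rw [padicValNat_factorial_of_lt_sq (by omega), padicValNat_factorial_of_lt_sq (by omega),
    padicValNat_factorial_of_lt_sq hn] at hv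
  have key {s : ℕ} (hs : s < p) : (2 * s + n % 2) / p =
      if (p + 1) / 2 - n % 2 ≤ s then 1 else 0 := by
    split_ifs with h
    · exact Nat.div_eq_of_lt_le (by omega) (by omega)
    · exact Nat.div_eq_of_lt (by omega)
  have hR := Nat.mod_lt (n / 2) hp0
  have hN := Nat.div_add_mod (n / 2) p
  set a := n / 2 / p
  set R := n / 2 % p
  have h1 : n / p = 2 * a + (2 * R + n % 2) / p := by
    rw [← Nat.mul_add_div hp0]
    congr 1
    have : p * (2 * a) = 2 * (p * a) := by ring
    omega
  have h2 : (2 * (p * i + w) + n % 2) / p = 2 * i + (2 * w + n % 2) / p := by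
    rw [← Nat.mul_add_div hp0]
    congr 1
    ring
  have h3 : (n / 2 - (p * i + w)) / p + i + (if R < w then 1 else 0) = a := by
    split_ifs with h
    · have hia : i < a := by
        by_contra hle
        have := Nat.mul_le_mul_left p (not_lt.1 hle)
        omega
      obtain ⟨b, hb⟩ : ∃ b, a = i + 1 + b := ⟨a - (i + 1), by omega⟩
      have : n / 2 - (p * i + w) = p * b + (p + R - w) := by
        rw [← hN, hb]
        have : p * (i + 1 + b) = p * i + p + p * b := by ring
        omega
      rw [this, Nat.mul_add_div hp0, Nat.div_eq_of_lt (by omega)]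
      omega
    · have hia : i ≤ a := by
        by_contra hle
        have := Nat.mul_le_mul_left p (show a + 1 ≤ i by omega)
        rw [mul_add] at this
        omega
      obtain ⟨b, hb⟩ : ∃ b, a = i + b := ⟨a - i, by omega⟩
      have : n / 2 - (p * i + w) = p * b + (R - w) := by
        rw [← hN, hb, mul_add]
        omega
      rw [this, Nat.mul_add_div hp0, Nat.div_eq_of_lt (by omega)]
      omega
  rw [h1, h2, key hR, key hw] at hv
  omega

/-- For `n < p ^ 2`, the positive slopes of the Newton polygon of `hermiteReduced n` at `p` are among
`1 / p` and `1 / β` where `β = (p + 1) / 2 - n % 2`. -/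
theorem hermiteReduced_slope_eq (hp : p ≠ 2) (hn : n < p ^ 2) {V : ℝ} (hV : 0 < V)
    (hU : ∀ i ≤ n / 2, ∃ j ≠ i, j ≤ n / 2 ∧
      padicValInt p ((hermiteReduced n).coeff j) + j * V ≤
        padicValInt p ((hermiteReduced n).coeff i) + i * V) :
    p * V = 1 ∨
      ((p + 1) / 2 - n % 2 : ℕ) * V = 1 ∧ (p + 1) / 2 - n % 2 ≤ n / 2 % p := by
  have hpr : p.Prime := Fact.out
  have hp0 := hpr.pos
  have hodd : p % 2 = 1 := hpr.eq_two_or_odd.resolve_left hp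
  have hp3 : 3 ≤ p := by have := hpr.two_le; omega
  have hval {i w : ℕ} (hj : p * i + w ≤ n / 2) (hw : w < p) :=
    padicValInt_coeff_hermiteReduced_of_lt_sq hp hn hj hw
  have hR := Nat.mod_lt (n / 2) hp0
  have hN := Nat.div_add_mod (n / 2) p
  have hβ0 : 0 < (p + 1) / 2 - n % 2 := by omega
  have hβp : (p + 1) / 2 - n % 2 < p := by omega
  generalize (p + 1) / 2 - n % 2 = β at *
  generalize n / 2 / p = a at *
  generalize n / 2 % p = R at *
  have hβ0' : (0 : ℝ) < β := by exact_mod_cast hβ0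
  have hβp' : (β : ℝ) + 1 ≤ p := by exact_mod_cast hβp
  have hU' (i w : ℕ) (hj : p * i + w ≤ n / 2) : ∃ i' w', w' < p ∧ (p * i' + w' ≠ p * i + w) ∧
      p * i' + w' ≤ n / 2 ∧ padicValInt p ((hermiteReduced n).coeff (p * i' + w')) +
        (p * i' + w' : ℝ) * V ≤ padicValInt p ((hermiteReduced n).coeff (p * i + w)) +
        (p * i + w : ℝ) * V := by
    obtain ⟨j, hji, hjn, hle⟩ := hU _ hj
    rw [← Nat.div_add_mod j p] at hji hjn hle
    exact ⟨j / p, j % p, Nat.mod_lt _ hp0, hji, hjn, by exact_mod_cast hle⟩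
  by_contra! hne
  obtain ⟨hne1, hne2⟩ := hne
  rcases lt_or_gt_of_ne hne1 with h1 | h1
  · obtain ⟨w₀, hw₀, hw₀R⟩ : ∃ w₀, w₀ = (if β ≤ R then β else 0) ∧ w₀ ≤ R :=
      ⟨_, rfl, by split_ifs <;> omega⟩
    have hj₀ : p * a + w₀ ≤ n / 2 := by omega
    obtain ⟨i, w, hw, hne, hj, hle⟩ := hU' a w₀ hj₀
    have hv := hval hj hw
    have hv0 := hval hj₀ (by omega)
    have hv0' : padicValInt p ((hermiteReduced n).coeff (p * a + w₀)) = 0 := by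
      split_ifs at * <;> omega
    rw [hv0', Nat.cast_zero, zero_add] at hle
    generalize padicValInt p ((hermiteReduced n).coeff (p * i + w)) = v at *
    have hlow : p * a + w₀ ≤ p * v + (p * i + w) := by
      have e : p * (a + (if β ≤ R then 1 else 0) + (if R < w then 1 else 0)) =
        p * (v + i + (if β ≤ w then 1 else 0)) := by rw [hv]
      simp only [mul_add, mul_ite, mul_one, mul_zero] at e
      split_ifs at * <;> omega
    have hlow' : (p * a + w₀ : ℝ) ≤ p * v + (p * i + w) := by exact_mod_cast hlow
    have hv' : (0 : ℝ) ≤ v := by positivity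
    rcases Nat.lt_or_gt_of_ne hne with hlt | hlt
    · have hlt' : (p * i + w : ℝ) < p * a + w₀ := by exact_mod_cast hlt
      have hvpos : (0 : ℝ) < v := by
        rcases hv'.lt_or_eq with h | h
        · exact h
        · rw [← h, mul_zero] at hlow'
          linarith
      nlinarith [mul_le_mul_of_nonneg_right hlow' hV.le, mul_lt_mul_of_pos_left h1 hvpos]
    · have hlt' : (p * a + w₀ : ℝ) < p * i + w := by exact_mod_cast hlt
      nlinarith
  · have hmul (i : ℕ) : 0 ≤ (i : ℝ) * (p * V - 1) := mul_nonneg (Nat.cast_nonneg i) (by linarith)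
    have hmul' {i : ℕ} (hi : i ≠ 0) : 0 < (i : ℝ) * (p * V - 1) :=
      mul_pos (by exact_mod_cast Nat.pos_of_ne_zero hi) (by linarith)
    by_cases hβR : β ≤ R ∧ β * V < 1
    · obtain ⟨hβR, h2⟩ := hβR
      obtain ⟨i, w, hw, hne, hj, hle⟩ := hU' 0 β (by omega)
      have hv := hval hj hw
      have hv0 := hval (i := 0) (w := β) (by omega) (by omega)
      rw [if_pos le_rfl, if_pos hβR, if_neg (by omega)] at hv0
      rw [if_pos hβR] at hv
      rw [show padicValInt p ((hermiteReduced n).coeff (p * 0 + β)) = a by omega] at hle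
      generalize padicValInt p ((hermiteReduced n).coeff (p * i + w)) = v at *
      push_cast at hle
      by_cases hwβ : β ≤ w
      · rw [if_pos hwβ] at hv
        have hv' : (a : ℝ) ≤ v + i := by exact_mod_cast (show a ≤ v + i by split_ifs at hv <;> omega)
        have hwβ' : (β : ℝ) ≤ w := by exact_mod_cast hwβ
        have h5 : (β : ℝ) * V ≤ w * V := by gcongr
        by_cases hi : i = 0
        · subst hi
          have hlt : (β : ℝ) < w := by exact_mod_cast (show β < w by omega)
          have : (β : ℝ) * V < w * V := by gcongr
          push_cast at hle hv'
          linarith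
        · linarith [hmul' hi]
      · rw [if_neg hwβ] at hv
        have hv' : (a + 1 : ℝ) ≤ v + i := by
          exact_mod_cast (show a + 1 ≤ v + i by split_ifs at hv <;> omega)
        have h5 : (0 : ℝ) ≤ w * V := by positivity
        linarith [hmul i]
    · obtain ⟨i, w, hw, hne, hj, hle⟩ := hU' 0 0 (by omega)
      have hv := hval hj hw
      have hv0 := hval (i := 0) (w := 0) (by omega) hp0
      generalize padicValInt p ((hermiteReduced n).coeff (p * i + w)) = v at *
      generalize padicValInt p ((hermiteReduced n).coeff (p * 0 + 0)) = v₀ at *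
      push_cast at hle
      rw [if_neg (show ¬ β ≤ 0 by omega), if_neg (show ¬ R < 0 by omega)] at hv0
      have h5 : (0 : ℝ) ≤ w * V := by positivity
      by_cases hc : β ≤ R ∧ β ≤ w
      · have h2 : 1 < β * V := by
          refine lt_of_le_of_ne (not_lt.1 fun h => hβR ⟨hc.1, h⟩) fun h => ?_
          exact absurd hc.1 (by have := hne2 h.symm; omega)
        have hwβ' : (β : ℝ) ≤ w := by exact_mod_cast hc.2
        have h6 : (β : ℝ) * V ≤ w * V := by gcongr
        have hv' : (v₀ : ℝ) ≤ v + i + 1 := by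
          exact_mod_cast (show v₀ ≤ v + i + 1 by split_ifs at hv hv0 <;> omega)
        linarith [hmul i]
      · have hv' : (v₀ : ℝ) ≤ v + i := by
          exact_mod_cast (show v₀ ≤ v + i by split_ifs at hv hv0 <;> omega)
        by_cases hi : i = 0
        · subst hi
          have : (0 : ℝ) < w := by exact_mod_cast (show 0 < w by omega)
          have : 0 < w * V := by positivity
          push_cast at hle hv'
          linarith
        · linarith [hmul' hi]

end Polynomial

theorem Multiset.card_eq_and_sum_eq_of_forall_mem {x y : ℝ} (hx : 0 < x) (hxy : x < y)
    {S : Multiset ℝ} (h : ∀ V ∈ S, V = 0 ∨ V = x ∨ V = y) :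
    S.card = S.count 0 + S.count x + S.count y ∧ S.sum = S.count x * x + S.count y * y := by
  induction S using Multiset.induction_on with
  | empty => simp
  | cons a S ih =>
    obtain ⟨h1, h2⟩ := ih fun V hV => h V (Multiset.mem_cons_of_mem hV)
    have hx0 := hx.ne'
    have hy0 := (hx.trans hxy).ne'
    rcases h a (Multiset.mem_cons_self a S) with rfl | rfl | rfl
    · rw [Multiset.card_cons, Multiset.sum_cons, Multiset.count_cons_self,
        Multiset.count_cons_of_ne hx0, Multiset.count_cons_of_ne hy0]
      exact ⟨by omega, by rw [h2, zero_add]⟩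
    · rw [Multiset.card_cons, Multiset.sum_cons, Multiset.count_cons_self,
        Multiset.count_cons_of_ne hx0.symm, Multiset.count_cons_of_ne hxy.ne']
      refine ⟨by omega, ?_⟩
      rw [h2]
      push_cast
      ring
    · rw [Multiset.card_cons, Multiset.sum_cons, Multiset.count_cons_self,
        Multiset.count_cons_of_ne hy0.symm, Multiset.count_cons_of_ne hxy.ne]
      refine ⟨by omega, ?_⟩
      rw [h2]
      push_cast
      ring

namespace Polynomial

variable {p : ℕ} [Fact p.Prime] {n : ℕ}

theorem two_mul_natDegree_mod_le_mod (hp : p ≠ 2) (hn : n < p ^ 2) {g : ℚ[X]} (hg : g.Monic)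
    (hgF : g ∣ (hermiteReduced n).map (Int.castRingHom ℚ)) :
    2 * g.natDegree % p ≤ n % p ∨ p ∣ 2 * g.natDegree + 1 := by
  obtain ⟨S, T, hST, hS, ⟨z, hz⟩, h0, hunit, hN, hU⟩ :=
    exists_newton_slopes_hermiteReduced hp hg hgF
  have hpr : p.Prime := Fact.out
  have hp0 := hpr.pos
  have hodd : p % 2 = 1 := hpr.eq_two_or_odd.resolve_left hp
  have hp3 : 3 ≤ p := by have := hpr.two_le; omega
  have hdm := Nat.div_add_mod (n / 2) p
  have hR := Nat.mod_lt (n / 2) hp0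
  obtain ⟨β, hβ⟩ : ∃ β, (p + 1) / 2 - n % 2 = β := ⟨_, rfl⟩
  have hβ0 : 0 < β := by omega
  have hβp : β < p := by omega
  have hp0' : (0 : ℝ) < p := by exact_mod_cast hp0
  have hβ0' : (0 : ℝ) < β := by exact_mod_cast hβ0
  have hβp' : (β : ℝ) < p := by exact_mod_cast hβp
  have hx0 : (0 : ℝ) < 1 / p := by positivity
  have hxy : (1 / p : ℝ) < 1 / β := by gcongr
  have hT (V : ℝ) (hV : V ∈ T) : V = 0 ∨ V = 1 / p ∨ V = 1 / β := by
    rcases (h0 V hV).eq_or_lt with h | h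
    · exact Or.inl h.symm
    · rcases hermiteReduced_slope_eq hp hn h (hU V hV) with h | ⟨h, -⟩
      · exact Or.inr (Or.inl (eq_one_div_of_mul_eq_one_right h))
      · exact Or.inr (Or.inr (by rw [← hβ]; exact eq_one_div_of_mul_eq_one_right h))
  have hβR (h : (1 / β : ℝ) ∈ T) : β ≤ n / 2 % p := by
    rcases hermiteReduced_slope_eq hp hn (hx0.trans hxy) (hU _ h) with h | ⟨-, h⟩
    · rw [mul_one_div, div_eq_one_iff_eq hβ0'.ne'] at h
      exact absurd h hβp'.ne'
    · rwa [hβ] at h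
  obtain ⟨hTc, hTs⟩ := Multiset.card_eq_and_sum_eq_of_forall_mem hx0 hxy hT
  obtain ⟨hSc, hSs⟩ := Multiset.card_eq_and_sum_eq_of_forall_mem hx0 hxy
    fun V hV => hT V (Multiset.mem_of_le hST hV)
  have hB : T.count (1 / β : ℝ) = 0 ∨ T.count (1 / β : ℝ) = β := by
    have hf : T.filter ((1 / p : ℝ) < ·) = T.filter ((1 / β : ℝ) = ·) :=
      Multiset.filter_congr fun V hV => by
        rcases hT V hV with rfl | rfl | rfl
        · exact iff_of_false hx0.not_gt (hx0.trans hxy).ne'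
        · exact iff_of_false (lt_irrefl _) hxy.ne'
        · exact iff_of_true hxy rfl
    have hf' : T.filter ((1 : ℝ) < ·) = 0 := Multiset.filter_eq_nil.2 fun V hV => by
      rw [not_lt]
      rcases hT V hV with rfl | rfl | rfl
      · exact zero_le_one
      · exact div_le_one_of_le₀ (by exact_mod_cast hp0) hp0'.le
      · exact div_le_one_of_le₀ (by exact_mod_cast hβ0) hβ0'.le
    have hv0 := (hN 1).2
    have hv := (hN (1 / p)).2
    have hle := (hN (1 / p)).1
    have hsum := congrArg Multiset.sum (Multiset.filter_add_not ((1 / p : ℝ) < ·) T)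
    have hsum' := congrArg Multiset.sum (Multiset.filter_add_not ((1 : ℝ) < ·) T)
    rw [Multiset.sum_add, hf, Multiset.filter_eq, Multiset.sum_replicate, nsmul_eq_mul] at hsum
    rw [Multiset.sum_add, hf', Multiset.sum_zero, zero_add] at hsum'
    rw [hf', Multiset.card_zero, hsum'] at hv0
    rw [hf, Multiset.filter_eq, Multiset.card_replicate] at hv
    rw [hf, Multiset.filter_eq, Multiset.card_replicate] at hle
    rw [← hv, ← hv0] at hsum
    generalize T.count (1 / β : ℝ) = B at *
    have hBd := Nat.div_add_mod B p
    have hBm := Nat.mod_lt B hp0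
    have hw := padicValInt_coeff_hermiteReduced_of_lt_sq hp hn (i := B / p) (w := B % p)
      (by omega) hBm
    have hw0 := padicValInt_coeff_hermiteReduced_of_lt_sq hp hn (i := 0) (w := 0)
      (by omega) hp0
    rw [hBd, hβ] at hw
    rw [hβ, mul_zero, zero_add, if_neg (show ¬ β ≤ 0 by omega),
      if_neg (show ¬ n / 2 % p < 0 by omega)] at hw0
    have key : B + β * (padicValInt p ((hermiteReduced n).coeff B)) =
        β * padicValInt p ((hermiteReduced n).coeff 0) := by
      have : (B : ℝ) + β * (padicValInt p ((hermiteReduced n).coeff B)) =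
        β * padicValInt p ((hermiteReduced n).coeff 0) := by
        rw [← hsum]
        field_simp
      exact_mod_cast this
    generalize padicValInt p ((hermiteReduced n).coeff B) = v at *
    generalize padicValInt p ((hermiteReduced n).coeff 0) = v₀ at *
    generalize B / p = q at *
    generalize B % p = w at *
    have hmul : β * (q) + q ≤ p * (q) := by
      have := Nat.mul_le_mul_right (q) (show β + 1 ≤ p by omega)
      rwa [add_mul, one_mul] at this
    by_cases hwβ : β ≤ w
    · have hv1 : v₀ ≤ v + q + 1 := by
        rw [if_pos hwβ] at hw
        split_ifs at hw hw0 <;> omega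
      have := Nat.mul_le_mul_left β hv1
      rw [mul_add, mul_add, mul_one] at this
      right
      have h0 : q = 0 := by omega
      rw [h0, mul_zero] at hBd this
      omega
    · have hv1 : v₀ ≤ v + q := by
        rw [if_neg hwβ] at hw
        split_ifs at hw hw0 <;> omega
      have := Nat.mul_le_mul_left β hv1
      rw [mul_add] at this
      left
      have h0 : q = 0 := by omega
      rw [h0, mul_zero] at hBd this
      omega
  have hu := Multiset.count_le_of_le 0 hST
  have hb := Multiset.count_le_of_le (1 / β : ℝ) hST
  have hβR' (h : S.count (1 / β : ℝ) ≠ 0) : β ≤ n / 2 % p :=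
    hβR (Multiset.count_ne_zero.1 (by omega))
  have hint : (β : ℤ) * S.count (1 / p : ℝ) + p * S.count (1 / β : ℝ) = p * β * z := by
    have : (β : ℝ) * S.count (1 / p : ℝ) + p * S.count (1 / β : ℝ) = p * β * z := by
      rw [← hz, hSs]
      field_simp
    exact_mod_cast this
  have hcop : Nat.Coprime p β := Nat.coprime_of_lt_prime hβ0.ne' hβp hpr
  rw [← hS, hSc]
  generalize S.count (1 / β : ℝ) = B at *
  generalize S.count (1 / p : ℝ) = A at *
  generalize S.count (0 : ℝ) = u at *
  have hpA : p ∣ A := by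
    have : (p : ℤ) ∣ β * A := ⟨β * z - B, by linear_combination hint⟩
    exact hcop.dvd_of_dvd_mul_left (by exact_mod_cast this)
  have hβB : β ∣ B := by
    have : (β : ℤ) ∣ p * B := ⟨p * z - A, by linear_combination hint⟩
    exact hcop.symm.dvd_of_dvd_mul_left (by exact_mod_cast this)
  obtain ⟨c, rfl⟩ := hpA
  have hnp : n % p = (2 * (n / 2 % p) + n % 2) % p := by
    conv_lhs => rw [show n = 2 * (n / 2 % p) + n % 2 + p * (2 * (n / 2 / p)) by
      rw [mul_left_comm]; omega]
    rw [Nat.add_mul_mod_self_left]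
  have hB' : B = 0 ∨ B = β := by
    rcases Nat.eq_zero_or_pos B with h | h
    · exact Or.inl h
    · have := Nat.le_of_dvd h hβB
      omega
  have hnp' := Nat.mod_lt n hp0
  rcases hB' with rfl | rfl
  · left
    rw [show 2 * (u + p * c + 0) = 2 * u + p * (2 * c) by ring, Nat.add_mul_mod_self_left,
      Nat.mod_eq_of_lt (by omega)]
    omega
  · have hle := hβR' hβ0.ne'
    rw [Nat.mod_eq_sub_mod (show p ≤ 2 * (n / 2 % p) + n % 2 by omega),
      Nat.mod_eq_of_lt (show 2 * (n / 2 % p) + n % 2 - p < p by omega)] at hnp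
    rcases Nat.mod_two_eq_zero_or_one n with hε | hε
    · left
      rw [show 2 * (u + p * c + B) = 2 * u + 1 + p * (2 * c + 1) by
        have : 2 * B = p + 1 := by omega
        linear_combination this, Nat.add_mul_mod_self_left, Nat.mod_eq_of_lt (by omega)]
      omega
    · rcases Nat.eq_zero_or_pos u with rfl | hu0
      · right
        exact ⟨2 * c + 1, by
          have : 2 * B + 1 = p := by omega
          linear_combination this⟩
      · left
        obtain ⟨s, rfl⟩ := Nat.exists_eq_add_of_le' hu0
        rw [show 2 * (s + 1 + p * c + B) = 2 * s + 1 + p * (2 * c + 1) by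
          have : 2 * B + 1 = p := by omega
          linear_combination this, Nat.add_mul_mod_self_left, Nat.mod_eq_of_lt (by omega)]
        omega

end Polynomial

namespace Polynomial

theorem hermiteFactorDegree_two_mul_natDegree {n : ℕ} {g : ℚ[X]} (hg : g.Monic)
    (hgF : g ∣ (hermiteReduced n).map (Int.castRingHom ℚ)) (hd : g.natDegree ≠ 0) :
    HermiteFactorDegree n (2 * g.natDegree) where
  le_mod_of_lt p hpr hp h :=
    have : Fact p.Prime := ⟨hpr⟩
    two_mul_natDegree_le_mod hp hg hgF hd (Or.inl h)
  le_mod_of_even hn p hpr hp h :=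
    have : Fact p.Prime := ⟨hpr⟩
    two_mul_natDegree_le_mod hp hg hgF hd (Or.inr ⟨hn, h⟩)
  mod_le_mod p hpr hp h :=
    have : Fact p.Prime := ⟨hpr⟩
    two_mul_natDegree_mod_le_mod hp h hg hgF

theorem not_isRoot_hermiteReduced_nine (r : ℚ) :
    ¬ ((hermiteReduced 9).map (Int.castRingHom ℚ)).IsRoot r := by
  intro h
  have h' : aeval r (hermiteReduced 9) = 0 := by
    rwa [IsRoot, eval_map] at h
  obtain ⟨m, rfl⟩ := isInteger_of_is_root_of_monic (monic_hermiteReduced 9) h'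
  rw [aeval_algebraMap_apply, map_eq_zero_iff _ (algebraMap ℤ ℚ).injective_int, coe_aeval_eq_eval,
    eval_eq_sum_range, natDegree_hermiteReduced] at h'
  have hc : (m ^ 4 - 36 * m ^ 3 + 378 * m ^ 2 - 1260 * m + 945 : ℤ) = 0 := by
    have h9 : ∀ j, (hermiteReduced 9).coeff j = if Even (9 + (2 * j + 1)) then
        (-1 : ℤ) ^ ((9 - (2 * j + 1)) / 2) * (9 - (2 * j + 1) - 1).doubleFactorial *
          Nat.choose 9 (2 * j + 1) else 0 :=
      fun j => by rw [coeff_hermiteReduced, coeff_hermite]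
    have c0 : (hermiteReduced 9).coeff 0 = 945 := by rw [h9]; decide
    have c1 : (hermiteReduced 9).coeff 1 = -1260 := by rw [h9]; decide
    have c2 : (hermiteReduced 9).coeff 2 = 378 := by rw [h9]; decide
    have c3 : (hermiteReduced 9).coeff 3 = -36 := by rw [h9]; decide
    have c4 : (hermiteReduced 9).coeff 4 = 1 := by rw [h9]; decide
    rw [show 9 / 2 + 1 = 5 from rfl] at h'
    simp only [Finset.sum_range_succ, Finset.sum_range_zero, c0, c1, c2, c3, c4] at h'
    linear_combination h'
  have hmod : ∀ m : ZMod 8, m ^ 4 - 36 * m ^ 3 + 378 * m ^ 2 - 1260 * m + 945 ≠ 0 := by decide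
  exact hmod m (by exact_mod_cast congrArg (Int.cast : ℤ → ZMod 8) hc)

theorem irreducible_map_hermiteReduced {n : ℕ} (hn : 2 ≤ n) :
    Irreducible ((hermiteReduced n).map (Int.castRingHom ℚ)) := by
  have hm := (monic_hermiteReduced n).map (Int.castRingHom ℚ)
  have hdeg : ((hermiteReduced n).map (Int.castRingHom ℚ)).natDegree = n / 2 := by
    rw [(monic_hermiteReduced n).natDegree_map, natDegree_hermiteReduced]
  rw [hm.irreducible_iff_natDegree']
  refine ⟨fun h => ?_, fun f g hf hg hfg hmem => ?_⟩
  · rw [h, natDegree_one] at hdeg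
    omega
  · rw [hdeg, Finset.mem_Ioc] at hmem
    have hgF : g ∣ (hermiteReduced n).map (Int.castRingHom ℚ) := ⟨f, by rw [← hfg, mul_comm]⟩
    obtain ⟨rfl, h2⟩ := (hermiteFactorDegree_two_mul_natDegree hg hgF
      (by omega)).eq_nine_and_eq_two (by omega) (even_two_mul _) (by omega)
    have h1 : g.degree = 1 := (degree_eq_iff_natDegree_eq hg.ne_zero).2 (by norm_num; omega)
    obtain ⟨r, hr⟩ := exists_root_of_degree_eq_one h1
    exact not_isRoot_hermiteReduced_nine r (hr.dvd hgF)

theorem derivative_hermite_succ (n : ℕ) :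
    derivative (hermite (n + 1)) = (n + 1 : ℤ[X]) * hermite n := by
  induction n with
  | zero => simp
  | succ n ih =>
    rw [hermite_succ (n + 1), derivative_sub, derivative_mul, derivative_X, ih, derivative_mul]
    conv_rhs => rw [hermite_succ n]
    have : derivative (n + 1 : ℤ[X]) = 0 := by simp
    rw [this, hermite_succ n]
    push_cast
    ring

theorem aeval_hermite_succ_ne_zero {A : Type*} [Field A] [CharZero A] {x : A} {n : ℕ}
    (h : aeval x (hermite n) = 0) : aeval x (hermite (n + 1)) ≠ 0 := by
  induction n with
  | zero => simp at h
  | succ n ih =>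
    intro h'
    rw [hermite_succ, map_sub, map_mul, h, mul_zero, zero_sub, neg_eq_zero,
      derivative_hermite_succ, map_mul, mul_eq_zero] at h'
    refine h'.elim (fun h0 => ?_) fun h0 => ih h0 h
    simp only [map_add, map_natCast, map_one] at h0
    exact Nat.cast_add_one_ne_zero n h0

/-- The square of a nonzero root of `hermite n` has minimal polynomial `hermiteReduced n`. -/
theorem minpoly_sq_of_aeval_hermite_eq_zero {A : Type*} [Field A] [Algebra ℚ A] {x : A} (hx : x ≠ 0)
    {n : ℕ} (h : aeval x (hermite n) = 0) :
    minpoly ℚ (x ^ 2) = (hermiteReduced n).map (Int.castRingHom ℚ) := by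
  have hn : 2 ≤ n := by
    by_contra hlt
    interval_cases n
    · simp at h
    · simp [hx] at h
  rw [hermite_eq_X_pow_mul_expand, map_mul, map_pow, aeval_X, expand_aeval, mul_eq_zero,
    or_iff_right (pow_ne_zero _ hx)] at h
  refine (minpoly.eq_of_irreducible_of_monic (irreducible_map_hermiteReduced hn) ?_
    ((monic_hermiteReduced n).map _)).symm
  rw [← h]
  exact aeval_map_algebraMap ℚ (x ^ 2) (hermiteReduced n)

end Polynomial

/-- **Distinct Hermite polynomials share at most the root `x = 0`** (via Schur's
irreducibility theorem): if `H_m(x) = H_n(x) = 0` for `m ≠ n` and real `x`, then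
`x = 0`.  Here `Polynomial.hermite` is the probabilists' Hermite polynomial. -/
theorem hermite_common_root_eq_zero (m n : ℕ) (hmn : m ≠ n) (x : ℝ)
    (hm : Polynomial.aeval x (Polynomial.hermite m) = 0)
    (hn : Polynomial.aeval x (Polynomial.hermite n) = 0) :
    x = 0 := by
  by_contra hx
  have hdeg : m / 2 = n / 2 := by
    have h := congrArg Polynomial.natDegree
      ((Polynomial.minpoly_sq_of_aeval_hermite_eq_zero hx hm).symm.trans
        (Polynomial.minpoly_sq_of_aeval_hermite_eq_zero hx hn))
    rwa [(Polynomial.monic_hermiteReduced m).natDegree_map,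
      (Polynomial.monic_hermiteReduced n).natDegree_map, Polynomial.natDegree_hermiteReduced,
      Polynomial.natDegree_hermiteReduced] at h
  obtain rfl | rfl : n = m + 1 ∨ m = n + 1 := by omega
  · exact Polynomial.aeval_hermite_succ_ne_zero hm hn
  · exact Polynomial.aeval_hermite_succ_ne_zero hn hm
end

section
/- (Moment determinacy for functions of exponential order) Let f, g : ℝ^d → ℝ be integrable functions of exponential order. If ∫_{ℝ^d} x^α f(x) dx = ∫_{ℝ^d} x^α g(x) dx for every multiindex α of nonnegative integers, then f = g almost everywhere. -/
open MeasureTheory Real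

noncomputable section

/-- `f` is integrable and of exponential order. -/
def ExpOrder {d : ℕ} (f : EuclideanSpace ℝ (Fin d) → ℝ) : Prop :=
  Integrable f ∧ ∃ C γ : ℝ, 0 < C ∧ 0 < γ ∧
    ∀ᵐ x : EuclideanSpace ℝ (Fin d), |f x| ≤ C * Real.exp (-γ * ‖x‖)

open ProbabilityTheory Topology
open scoped RealInnerProductSpace

/-- Two random variables with finite exponential moments near zero and the same moments have the
same complex moment generating function on their common strip of analyticity. -/
theorem complexMGF_eq_of_moment_eq {Ω Ω' : Type*} {mΩ : MeasurableSpace Ω}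
    {mΩ' : MeasurableSpace Ω'} {μ : Measure Ω} {ν : Measure Ω'} {X : Ω → ℝ} {Y : Ω' → ℝ}
    (hX : 0 ∈ interior (integrableExpSet X μ)) (hY : 0 ∈ interior (integrableExpSet Y ν))
    (hXY : ∀ n : ℕ, ∫ ω, X ω ^ n ∂μ = ∫ ω, Y ω ^ n ∂ν) {z : ℂ}
    (hzX : z.re ∈ interior (integrableExpSet X μ))
    (hzY : z.re ∈ interior (integrableExpSet Y ν)) :
    complexMGF X μ z = complexMGF Y ν z := by
  set U : Set ℂ :=
    Complex.re ⁻¹' (interior (integrableExpSet X μ) ∩ interior (integrableExpSet Y ν)) with hU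
  have hX' : AnalyticOnNhd ℂ (complexMGF X μ) U :=
    analyticOnNhd_complexMGF.mono fun w hw => hw.1
  have hY' : AnalyticOnNhd ℂ (complexMGF Y ν) U :=
    analyticOnNhd_complexMGF.mono fun w hw => hw.2
  have hconv : Convex ℝ U :=
    (convex_integrableExpSet.interior.inter convex_integrableExpSet.interior).linear_preimage
      Complex.reLm
  have h0 : (0 : ℂ) ∈ U := ⟨by simpa using hX, by simpa using hY⟩
  have hEq : complexMGF X μ =ᶠ[𝓝 0] complexMGF Y ν := by
    have htop : analyticOrderAt (complexMGF X μ - complexMGF Y ν) 0 = ⊤ := by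
      refine ENat.eq_top_iff_forall_ge.2 fun n => ?_
      rw [natCast_le_analyticOrderAt_iff_iteratedDeriv_eq_zero ((hX' 0 h0).sub (hY' 0 h0))]
      intro i _
      rw [iteratedDeriv_sub (hX' 0 h0).contDiffAt (hY' 0 h0).contDiffAt,
        iteratedDeriv_complexMGF (by simpa using hX), iteratedDeriv_complexMGF (by simpa using hY),
        sub_eq_zero]
      simp only [zero_mul, Complex.exp_zero, mul_one, ← Complex.ofReal_pow]
      rw [integral_complex_ofReal, integral_complex_ofReal, hXY i]
    filter_upwards [analyticOrderAt_eq_top.1 htop] with w hw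
    exact sub_eq_zero.1 hw
  exact hX'.eqOn_of_preconnected_of_eventuallyEq hY' hconv.isPreconnected h0 hEq ⟨hzX, hzY⟩

/-- If the norm has an exponential moment, then so does every linear functional. -/
theorem zero_mem_interior_integrableExpSet_inner {E : Type*} [NormedAddCommGroup E]
    [InnerProductSpace ℝ E] [MeasurableSpace E] [BorelSpace E] [SecondCountableTopology E]
    {μ : Measure E} {a : ℝ} (ha : 0 < a) (hμ : Integrable (fun x => exp (a * ‖x‖)) μ) (t : E) :
    0 ∈ interior (integrableExpSet (fun x => ⟪x, t⟫) μ) := by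
  rw [mem_interior_iff_mem_nhds, Metric.mem_nhds_iff]
  refine ⟨a / (‖t‖ + 1), by positivity, fun s hs => ?_⟩
  rw [mem_ball_zero_iff, norm_eq_abs, lt_div_iff₀ (by positivity)] at hs
  refine hμ.mono' (by fun_prop) (.of_forall fun x => ?_)
  rw [norm_of_nonneg (exp_pos _).le, exp_le_exp]
  calc s * ⟪x, t⟫ ≤ |s| * (‖x‖ * ‖t‖) := by
        refine (le_abs_self _).trans ?_
        rw [abs_mul]
        gcongr
        exact abs_real_inner_le_norm x t
    _ = |s| * ‖t‖ * ‖x‖ := by ring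
    _ ≤ a * ‖x‖ := by
        gcongr
        nlinarith [abs_nonneg s]

/-- Finite measures for which the norm has an exponential moment are determined by the moments of
linear functionals. -/
theorem MeasureTheory.Measure.ext_of_moment_inner {E : Type*} [NormedAddCommGroup E]
    [InnerProductSpace ℝ E] [CompleteSpace E] [MeasurableSpace E] [BorelSpace E]
    [SecondCountableTopology E] {μ ν : Measure E} [IsFiniteMeasure μ] [IsFiniteMeasure ν]
    {a : ℝ} (ha : 0 < a) (hμ : Integrable (fun x => exp (a * ‖x‖)) μ)
    (hν : Integrable (fun x => exp (a * ‖x‖)) ν)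
    (h : ∀ (t : E) (n : ℕ), ∫ x, ⟪x, t⟫ ^ n ∂μ = ∫ x, ⟪x, t⟫ ^ n ∂ν) : μ = ν := by
  refine Measure.ext_of_charFun (funext fun t => ?_)
  have hμt := zero_mem_interior_integrableExpSet_inner ha hμ t
  have hνt := zero_mem_interior_integrableExpSet_inner ha hν t
  have := complexMGF_eq_of_moment_eq hμt hνt (h t) (z := Complex.I) (by simpa using hμt)
    (by simpa using hνt)
  simpa only [complexMGF, charFun, mul_comm Complex.I] using this

theorem pow_le_const_mul_exp {a : ℝ} (ha : 0 < a) (n : ℕ) {r : ℝ} (hr : 0 ≤ r) :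
    r ^ n ≤ n.factorial / a ^ n * exp (a * r) := by
  have := pow_div_factorial_le_exp (a * r) (by positivity) n
  rw [div_le_iff₀ (by positivity), mul_pow] at this
  rw [div_mul_eq_mul_div, le_div_iff₀ (by positivity)]
  linarith

theorem abs_monomial_le {d : ℕ} {a : ℝ} (ha : 0 < a) (α : Fin d → ℕ)
    (x : EuclideanSpace ℝ (Fin d)) :
    |∏ i, x i ^ α i| ≤ (∑ i, α i).factorial / a ^ (∑ i, α i) * exp (a * ‖x‖) := by
  refine le_trans ?_ (pow_le_const_mul_exp ha _ (norm_nonneg x))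
  rw [Finset.abs_prod, ← Finset.prod_pow_eq_pow_sum]
  refine Finset.prod_le_prod (fun _ _ => abs_nonneg _) fun i _ => ?_
  rw [abs_pow]
  gcongr
  exact PiLp.norm_apply_le x i

theorem integrable_monomial_mul {d : ℕ} {a : ℝ} (ha : 0 < a)
    {μ : Measure (EuclideanSpace ℝ (Fin d))} {f : EuclideanSpace ℝ (Fin d) → ℝ}
    (hf : AEStronglyMeasurable f μ) (h : Integrable (fun x => exp (a * ‖x‖) * f x) μ)
    (α : Fin d → ℕ) : Integrable (fun x => (∏ i, x i ^ α i) * f x) μ := by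
  refine (h.norm.const_mul ((∑ i, α i).factorial / a ^ (∑ i, α i))).mono'
    (AEStronglyMeasurable.mul (by fun_prop) hf) (.of_forall fun x => ?_)
  rw [norm_mul, norm_mul, ← mul_assoc, norm_of_nonneg (exp_pos _).le]
  gcongr
  exact abs_monomial_le ha α x

theorem integrable_monomial {d : ℕ} {a : ℝ} (ha : 0 < a)
    {μ : Measure (EuclideanSpace ℝ (Fin d))} (hμ : Integrable (fun x => exp (a * ‖x‖)) μ)
    (α : Fin d → ℕ) : Integrable (fun x => ∏ i, x i ^ α i) μ := by
  simpa using integrable_monomial_mul ha (f := fun _ => 1) (by fun_prop) (by simpa using hμ) α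

/-- Finite measures on Euclidean space for which the norm has an exponential moment are determined
by their moments. -/
theorem MeasureTheory.Measure.ext_of_moments {d : ℕ} {μ ν : Measure (EuclideanSpace ℝ (Fin d))}
    [IsFiniteMeasure μ] [IsFiniteMeasure ν] {a : ℝ} (ha : 0 < a)
    (hμ : Integrable (fun x => exp (a * ‖x‖)) μ) (hν : Integrable (fun x => exp (a * ‖x‖)) ν)
    (h : ∀ α : Fin d → ℕ, ∫ x, ∏ i, x i ^ α i ∂μ = ∫ x, ∏ i, x i ^ α i ∂ν) : μ = ν := by
  refine Measure.ext_of_moment_inner ha hμ hν fun t n => ?_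
  have key (x : EuclideanSpace ℝ (Fin d)) : ⟪x, t⟫ ^ n =
      ∑ k ∈ Finset.piAntidiag Finset.univ n,
        (Nat.multinomial Finset.univ k * ∏ i, t i ^ k i) * ∏ i, x i ^ k i := by
    rw [PiLp.inner_apply, Finset.sum_pow_eq_sum_piAntidiag]
    refine Finset.sum_congr rfl fun k _ => ?_
    simp only [RCLike.inner_apply, conj_trivial, mul_pow, Finset.prod_mul_distrib]
    ring
  simp only [key]
  rw [integral_finsetSum _ fun k _ => (integrable_monomial ha hμ k).const_mul _,
    integral_finsetSum _ fun k _ => (integrable_monomial ha hν k).const_mul _]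
  simp only [integral_const_mul, h]

theorem integrable_exp_neg_mul_norm {d : ℕ} {a : ℝ} (ha : 0 < a) :
    Integrable (fun x : EuclideanSpace ℝ (Fin d) => exp (-a * ‖x‖)) := by
  have h := integrable_one_add_norm (E := EuclideanSpace ℝ (Fin d)) (μ := volume)
    (r := (d + 1 : ℕ)) (by simp)
  refine (h.const_mul ((d + 1).factorial / a ^ (d + 1) * exp a)).mono' (by fun_prop)
    (.of_forall fun x => ?_)
  have h1 := pow_le_const_mul_exp ha (d + 1) (r := 1 + ‖x‖) (by positivity)
  rw [norm_of_nonneg (exp_pos _).le, rpow_neg (by positivity), rpow_natCast, ← div_eq_mul_inv,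
    le_div_iff₀ (by positivity)]
  calc exp (-a * ‖x‖) * (1 + ‖x‖) ^ (d + 1)
      ≤ exp (-a * ‖x‖) * ((d + 1).factorial / a ^ (d + 1) * exp (a * (1 + ‖x‖))) := by gcongr
    _ = (d + 1).factorial / a ^ (d + 1) * (exp (-a * ‖x‖) * exp (a * (1 + ‖x‖))) := by ring
    _ = (d + 1).factorial / a ^ (d + 1) * exp a := by rw [← exp_add]; ring_nf

theorem ExpOrder.exists_forall_integrable {d : ℕ} {f : EuclideanSpace ℝ (Fin d) → ℝ}
    (hf : ExpOrder f) :
    ∃ γ > 0, ∀ a < γ, Integrable (fun x => exp (a * ‖x‖) * f x) := by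
  obtain ⟨hf, C, γ, hC, hγ, hb⟩ := hf
  refine ⟨γ, hγ, fun a ha => ?_⟩
  refine ((integrable_exp_neg_mul_norm (sub_pos.2 ha)).const_mul C).mono'
    (AEStronglyMeasurable.mul (by fun_prop) hf.1) ?_
  filter_upwards [hb] with x hx
  rw [norm_mul, norm_of_nonneg (exp_pos _).le, norm_eq_abs]
  calc exp (a * ‖x‖) * |f x| ≤ exp (a * ‖x‖) * (C * exp (-γ * ‖x‖)) := by gcongr
    _ = C * (exp (a * ‖x‖) * exp (-γ * ‖x‖)) := by ring
    _ = C * exp (-(γ - a) * ‖x‖) := by rw [← exp_add]; ring_nf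

/-- An exponentially integrable function all of whose moments vanish is zero almost everywhere. -/
theorem ae_eq_zero_of_moments_eq_zero {d : ℕ} {h : EuclideanSpace ℝ (Fin d) → ℝ}
    (hh : Integrable h) {a : ℝ} (ha : 0 < a) (hexp : Integrable (fun x => exp (a * ‖x‖) * h x))
    (hmom : ∀ α : Fin d → ℕ, ∫ x, (∏ i, x i ^ α i) * h x = 0) : ∀ᵐ x, h x = 0 := by
  have hp : AEMeasurable (fun x => ENNReal.ofReal (h x)) := hh.1.aemeasurable.ennreal_ofReal
  have hn : AEMeasurable (fun x => ENNReal.ofReal (-h x)) := hh.1.aemeasurable.neg.ennreal_ofReal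
  have hint {k : EuclideanSpace ℝ (Fin d) → ℝ} (hk : AEStronglyMeasurable k)
      (hkh : ∀ x, |k x| = |h x|) :
      Integrable (fun x => exp (a * ‖x‖)) (volume.withDensity fun x => ENNReal.ofReal (k x)) := by
    rw [integrable_withDensity_iff_integrable_smul₀' hk.aemeasurable.ennreal_ofReal
      (.of_forall fun _ => ENNReal.ofReal_lt_top)]
    refine hexp.norm.mono' (AEStronglyMeasurable.smul
      hk.aemeasurable.ennreal_ofReal.ennreal_toReal.aestronglyMeasurable (by fun_prop))
      (.of_forall fun x => ?_)
    rw [smul_eq_mul, norm_mul, norm_mul, mul_comm]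
    gcongr
    rw [norm_eq_abs, norm_eq_abs, ← hkh, ENNReal.toReal_ofReal', abs_of_nonneg (le_max_right _ _)]
    exact max_le (le_abs_self _) (abs_nonneg _)
  have hintp := hint hh.1 fun _ => rfl
  have hintn := hint (k := fun x => -h x) hh.1.neg fun _ => abs_neg _
  have := isFiniteMeasure_withDensity_ofReal hh.2
  have := isFiniteMeasure_withDensity_ofReal hh.neg.2
  have heq : volume.withDensity (fun x => ENNReal.ofReal (h x)) =
      volume.withDensity (fun x => ENNReal.ofReal (-h x)) := by
    refine Measure.ext_of_moments ha hintp hintn fun α => ?_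
    have hip := integrable_monomial ha hintp α
    have hin := integrable_monomial ha hintn α
    rw [integrable_withDensity_iff_integrable_smul₀' hp
      (.of_forall fun _ => ENNReal.ofReal_lt_top)] at hip
    rw [integrable_withDensity_iff_integrable_smul₀' hn
      (.of_forall fun _ => ENNReal.ofReal_lt_top)] at hin
    rw [integral_withDensity_eq_integral_toReal_smul₀ hp
        (.of_forall fun _ => ENNReal.ofReal_lt_top),
      integral_withDensity_eq_integral_toReal_smul₀ hn
        (.of_forall fun _ => ENNReal.ofReal_lt_top),
      ← sub_eq_zero, ← integral_sub hip hin, ← hmom α]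
    refine integral_congr_ae (.of_forall fun x => ?_)
    simp only [ENNReal.toReal_ofReal', smul_eq_mul]
    rw [← sub_mul, max_zero_sub_max_neg_zero_eq_self, mul_comm]
  rw [withDensity_eq_iff_of_sigmaFinite hp hn] at heq
  filter_upwards [heq] with x hx
  have := congrArg ENNReal.toReal hx
  rw [ENNReal.toReal_ofReal', ENNReal.toReal_ofReal'] at this
  rw [← max_zero_sub_max_neg_zero_eq_self (h x), this, sub_self]

/-- **Moment determinacy for functions of exponential order**: two integrable functions
of exponential order with identical moments of all orders agree almost everywhere. -/
theorem moment_determinacy_exp_order {d : ℕ}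
    (f g : EuclideanSpace ℝ (Fin d) → ℝ) (hf : ExpOrder f) (hg : ExpOrder g)
    (hmom : ∀ α : Fin d → ℕ,
      (∫ x : EuclideanSpace ℝ (Fin d), (∏ i, (x i) ^ (α i)) * f x) =
      (∫ x : EuclideanSpace ℝ (Fin d), (∏ i, (x i) ^ (α i)) * g x)) :
    ∀ᵐ x : EuclideanSpace ℝ (Fin d), f x = g x := by
  obtain ⟨γ₁, hγ₁, hf'⟩ := hf.exists_forall_integrable
  obtain ⟨γ₂, hγ₂, hg'⟩ := hg.exists_forall_integrable
  obtain ⟨a, ha, haγ⟩ := exists_between (lt_min hγ₁ hγ₂)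
  have hfa := hf' a (haγ.trans_le (min_le_left _ _))
  have hga := hg' a (haγ.trans_le (min_le_right _ _))
  have := ae_eq_zero_of_moments_eq_zero (hf.1.sub hg.1) ha
    ((hfa.sub hga).congr (.of_forall fun x => (mul_sub _ _ _).symm)) fun α => by
      simp only [Pi.sub_apply, mul_sub]
      rw [integral_sub (integrable_monomial_mul ha hf.1.1 hfa α)
        (integrable_monomial_mul ha hg.1.1 hga α), hmom α, sub_self]
  filter_upwards [this] with x hx
  exact sub_eq_zero.1 hx
end
end
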